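/- arXiv:2410.12981 — 2 statements merged into one kernel-verified Lean document; each statement's English description precedes it below -/
import Mathlib

section
/- Let H be a nonempty finite simple graph and let m ≤ e(H) be a positive integer. Then there exists a spanning subgraph H' of H with exactly m edges such that Δ(H') - δ(H') ≤ Δ(H) - δ(H) + 2, where Δ and δ denote maximum and minimum degree. -/
open scoped Classical

/-- `c` is a proper edge colouring of `K` with colours in `C`. -/
structure PropCol {V : Type*} (K : SimpleGraph V) (C : Finset ℕ) (c : V → V → ℕ) : Prop where
  symm : ∀ x y, c x y = c y x
  mem : ∀ x y, K.Adj x y → c x y ∈ C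
  inj : ∀ x y z, K.Adj x y → K.Adj x z → c x y = c x z → y = z

/-- The two-coloured subgraph. -/
def kempe {V : Type*} (K : SimpleGraph V) (c : V → V → ℕ) (hs : ∀ x y, c x y = c y x)
    (i j : ℕ) : SimpleGraph V where
  Adj x y := K.Adj x y ∧ (c x y = i ∨ c x y = j)
  symm := ⟨fun x y h => ⟨h.1.symm, by rw [hs y x]; exact h.2⟩⟩
  loopless := ⟨fun x h => K.loopless.irrefl x h.1⟩

/-- A connected finite graph with maximum degree at most two has at most two vertices
of degree at most one. -/
lemma conn_le_two {W : Type*} [Fintype W] (B : SimpleGraph W) (hB : B.Connected)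
    (h2 : ∀ w, B.degree w ≤ 2) (P : Finset W) (hP : ∀ w ∈ P, B.degree w ≤ 1) : P.card ≤ 2 := by
  have h1 := hB.card_vert_le_card_edgeSet_add_one
  rw [Nat.card_eq_fintype_card, Nat.card_eq_fintype_card, ← SimpleGraph.edgeFinset_card] at h1
  have h3 := B.sum_degrees_eq_twice_card_edges
  have h4 : ∑ w, (B.degree w + if w ∈ P then 1 else 0) ≤ ∑ w : W, 2 := by
    apply Finset.sum_le_sum
    intro w _
    split_ifs with h
    · have := hP w h
      omega
    · exact h2 w
  rw [Finset.sum_add_distrib] at h4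
  simp at h4
  omega

lemma deg_le {W : Type*} (B : SimpleGraph W) (w : W) [Fintype (B.neighborSet w)]
    (g : W → ℕ) (F : Finset ℕ) (hm : ∀ y, B.Adj w y → g y ∈ F)
    (hi : ∀ y z, B.Adj w y → B.Adj w z → g y = g z → y = z) : B.degree w ≤ F.card := by
  rw [← SimpleGraph.card_neighborFinset_eq_degree]
  apply Finset.card_le_card_of_injOn g
  · intro y hy
    exact hm y (by simpa using hy)
  · intro y hy z hz h
    exact hi y z (by simpa using hy) (by simpa using hz) h

lemma kempe_comp {V : Type*} [Fintype V] (K : SimpleGraph V) (C : Finset ℕ) (c : V → V → ℕ)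
    (hc : PropCol K C c) (i j : ℕ) (X : Finset V)
    (hX : ∀ x ∈ X, ∀ y, K.Adj x y → c x y ≠ i)
    (S : (kempe K c hc.symm i j).ConnectedComponent) :
    (X.filter (fun x => (kempe K c hc.symm i j).connectedComponentMk x = S)).card ≤ 2 := by
  have hcon : ((kempe K c hc.symm i j).induce S.supp).Connected := S.connected_toSimpleGraph
  have hadj : ∀ w y : S.supp, ((kempe K c hc.symm i j).induce S.supp).Adj w y →
      K.Adj w y ∧ (c w y = i ∨ c w y = j) := fun w y h => h
  have key := conn_le_two _ hcon (by
      intro w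
      refine (deg_le _ w (fun y => c w y) {i, j} ?_ ?_).trans Finset.card_le_two
      · intro y hy
        simpa using (hadj _ _ hy).2
      · intro y z hy hz h
        exact Subtype.ext (hc.inj _ _ _ (hadj _ _ hy).1 (hadj _ _ hz).1 h))
    (Finset.univ.filter (fun w : S.supp => (w : V) ∈ X)) (by
      intro w hw
      have hw' : (w : V) ∈ X := by simpa using hw
      refine (deg_le _ w (fun y => c w y) {j} ?_ ?_).trans (by simp)
      · intro y hy
        have h1 := hX _ hw' _ (hadj _ _ hy).1
        have h3 := (hadj _ _ hy).2
        simp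
        tauto
      · intro y z hy hz h
        exact Subtype.ext (hc.inj _ _ _ (hadj _ _ hy).1 (hadj _ _ hz).1 h))
  refine le_trans ?_ key
  rw [← Finset.card_map (Function.Embedding.subtype (· ∈ S.supp))]
  apply Finset.card_le_card
  intro x hx
  simp only [Finset.mem_filter] at hx
  simp only [Finset.mem_map, Finset.mem_filter, Finset.mem_univ, true_and]
  exact ⟨⟨x, hx.2⟩, hx.1, rfl⟩

/-- A state: a proper colouring with lists of missing colours. -/
structure State {V : Type*} (K : SimpleGraph V) (C : Finset ℕ) (N : Finset V) (s : V → ℕ)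
    (c : V → V → ℕ) (A : V → Finset ℕ) : Prop where
  col : PropCol K C c
  sub : ∀ w ∈ N, A w ⊆ C
  miss : ∀ w ∈ N, ∀ y, K.Adj w y → c w y ∉ A w
  card : ∀ w ∈ N, (A w).card = s w

/-- The potential. -/
noncomputable def pot {V : Type*} (C : Finset ℕ) (N : Finset V) (A : V → Finset ℕ) : ℕ :=
  ∑ i ∈ C, (N.filter (fun w => i ∈ A w)).card ^ 2

lemma swap_step {V : Type*} [Fintype V] (K : SimpleGraph V) (C : Finset ℕ) (N : Finset V)
    (s : V → ℕ) (c : V → V → ℕ) (A : V → Finset ℕ) (h : State K C N s c A)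
    (i j : ℕ) (hi : i ∈ C) (hj : j ∈ C)
    (hij : (N.filter (fun w => j ∈ A w)).card + 3 ≤ (N.filter (fun w => i ∈ A w)).card) :
    ∃ c' A', State K C N s c' A' ∧ pot C N A' < pot C N A := by
  have hne : i ≠ j := by
    rintro rfl
    omega
  set Q := kempe K c h.col.symm i j with hQ
  obtain ⟨S, hS⟩ : ∃ S : Q.ConnectedComponent,
      ((N.filter (fun w => j ∈ A w)).filter (fun x => Q.connectedComponentMk x = S)).card <
      ((N.filter (fun w => i ∈ A w)).filter (fun x => Q.connectedComponentMk x = S)).card := by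
    by_contra hcon
    push Not at hcon
    have e1 := Finset.card_eq_sum_card_fiberwise (s := N.filter (fun w => i ∈ A w))
      (f := Q.connectedComponentMk) (t := Finset.univ) (by intro x _; simp)
    have e2 := Finset.card_eq_sum_card_fiberwise (s := N.filter (fun w => j ∈ A w))
      (f := Q.connectedComponentMk) (t := Finset.univ) (by intro x _; simp)
    have e3 := Finset.sum_le_sum (s := Finset.univ) (fun S _ => hcon S)
    omega
  have hS2 := kempe_comp K C c h.col i j (N.filter (fun w => i ∈ A w)) (by
    intro x hx y hxy he
    simp only [Finset.mem_filter] at hx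
    exact h.miss x hx.1 y hxy (he ▸ hx.2)) S
  let inS : V → Prop := fun x => Q.connectedComponentMk x = S
  have hclosed : ∀ x y, K.Adj x y → (c x y = i ∨ c x y = j) → (inS x ↔ inS y) := by
    intro x y hxy hcxy
    have hadj : Q.Adj x y := ⟨hxy, hcxy⟩
    have := SimpleGraph.ConnectedComponent.connectedComponentMk_eq_of_adj hadj
    simp only [inS, this]
  let τ : V → Equiv.Perm ℕ := fun x => if inS x then Equiv.swap i j else 1
  let c' : V → V → ℕ := fun x y => if inS x ∨ inS y then Equiv.swap i j (c x y) else c x y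
  have hc' : ∀ x y, K.Adj x y → c' x y = τ x (c x y) := by
    intro x y hxy
    by_cases hx : inS x
    · simp [c', τ, hx]
    · by_cases hy : inS y
      · have : ¬ (c x y = i ∨ c x y = j) := fun hh => hx ((hclosed x y hxy hh).2 hy)
        push Not at this
        simp [c', τ, hx, hy, Equiv.swap_apply_of_ne_of_ne this.1 this.2]
      · simp [c', τ, hx, hy]
  have hτC : ∀ x a, a ∈ C → τ x a ∈ C := by
    intro x a ha
    by_cases hx : inS x
    · simp only [τ, hx, if_true]
      rw [Equiv.swap_apply_def]
      split_ifs <;> assumption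
    · simpa [τ, hx] using ha
  let A' : V → Finset ℕ := fun x => (A x).map (τ x).toEmbedding
  refine ⟨c', A', ⟨⟨?_, ?_, ?_⟩, ?_, ?_, ?_⟩, ?_⟩
  · intro x y
    simp only [c', h.col.symm x y, or_comm]
  · intro x y hxy
    rw [hc' x y hxy]
    exact hτC _ _ (h.col.mem x y hxy)
  · intro x y z hxy hxz he
    rw [hc' x y hxy, hc' x z hxz] at he
    exact h.col.inj x y z hxy hxz ((τ x).injective he)
  · intro w hw a ha
    simp only [A', Finset.mem_map, Equiv.coe_toEmbedding] at ha
    obtain ⟨b, hb, rfl⟩ := ha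
    exact hτC _ _ (h.sub w hw hb)
  · intro w hw y hy hm
    rw [hc' w y hy] at hm
    simp only [A', Finset.mem_map, Equiv.coe_toEmbedding] at hm
    obtain ⟨b, hb, hbe⟩ := hm
    exact h.miss w hw y hy ((τ w).injective hbe ▸ hb)
  · intro w hw
    simp [A', h.card w hw]
  · have hmem : ∀ x a, a ∈ A' x ↔ (if inS x then Equiv.swap i j a ∈ A x else a ∈ A x) := by
      intro x a
      by_cases hx : inS x
      · simp only [A', τ, hx, if_true, Finset.mem_map_equiv, Equiv.symm_swap]
      · simp [A', τ, hx]
        rfl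
    have ho : ∀ l ∈ (C.erase i).erase j, (N.filter (fun w => l ∈ A' w)).card ^ 2
        = (N.filter (fun w => l ∈ A w)).card ^ 2 := by
      intro l hl
      simp only [Finset.mem_erase] at hl
      congr 2
      apply Finset.filter_congr
      intro x _
      rw [hmem, Equiv.swap_apply_of_ne_of_ne hl.2.1 hl.1]
      simp
    have hsplit : ∀ B : V → Finset ℕ, pot C N B = (N.filter (fun w => i ∈ B w)).card ^ 2 +
        ((N.filter (fun w => j ∈ B w)).card ^ 2 +
        ∑ l ∈ (C.erase i).erase j, (N.filter (fun w => l ∈ B w)).card ^ 2) := by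
      intro B
      unfold pot
      rw [← Finset.add_sum_erase C _ hi,
        ← Finset.add_sum_erase (C.erase i) _ (Finset.mem_erase.2 ⟨hne.symm, hj⟩)]
    rw [hsplit A', hsplit A, Finset.sum_congr rfl ho]
    have hcards : ∀ X : Finset V, X.card = (X.filter inS).card + (X.filter (fun x => ¬ inS x)).card :=
      fun X => (Finset.card_filter_add_card_filter_not inS).symm
    have f1 : (N.filter (fun w => i ∈ A' w)).filter inS = (N.filter (fun w => j ∈ A w)).filter inS := by
      ext x
      simp only [Finset.mem_filter, hmem, Equiv.swap_apply_left]
      by_cases hx : inS x <;> simp [hx]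
    have f2 : (N.filter (fun w => j ∈ A' w)).filter inS = (N.filter (fun w => i ∈ A w)).filter inS := by
      ext x
      simp only [Finset.mem_filter, hmem, Equiv.swap_apply_right]
      by_cases hx : inS x <;> simp [hx]
    have f3 : ∀ l, (N.filter (fun w => l ∈ A' w)).filter (fun x => ¬ inS x)
        = (N.filter (fun w => l ∈ A w)).filter (fun x => ¬ inS x) := by
      intro l
      ext x
      simp only [Finset.mem_filter, hmem]
      by_cases hx : inS x <;> simp [hx]
    have g1 := hcards (N.filter (fun w => i ∈ A w))
    have g2 := hcards (N.filter (fun w => j ∈ A w))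
    rw [hcards (N.filter (fun w => i ∈ A' w)), hcards (N.filter (fun w => j ∈ A' w)), f1, f2, f3, f3,
      ]
    rw [g1, g2] at hij
    rw [g1, g2]
    change ((N.filter (fun w => j ∈ A w)).filter inS).card <
      ((N.filter (fun w => i ∈ A w)).filter inS).card at hS
    change ((N.filter (fun w => i ∈ A w)).filter inS).card ≤ 2 at hS2
    generalize ((N.filter (fun w => j ∈ A w)).filter inS).card = q at *
    generalize ((N.filter (fun w => i ∈ A w)).filter inS).card = p at *
    generalize ((N.filter (fun w => j ∈ A w)).filter (fun x => ¬ inS x)).card = b at *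
    generalize ((N.filter (fun w => i ∈ A w)).filter (fun x => ¬ inS x)).card = a at *
    rw [← add_assoc, ← add_assoc]
    apply Nat.add_lt_add_right
    obtain ⟨t, rfl⟩ : ∃ t, p = q + t + 1 := ⟨p - q - 1, by omega⟩
    nlinarith

lemma odd_claim (C : Finset ℕ) (g : ℕ → ℕ) (n : ℕ) (hn : n ≤ C.card)
    (hs : ∑ i ∈ C, g i + 1 = 2 * n) (hb : ∀ i ∈ C, ∀ j ∈ C, g i < g j + 3) :
    ∃ i ∈ C, g i = 1 := by
  by_contra hcon
  push Not at hcon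
  by_cases hz : ∃ j ∈ C, g j = 0
  · obtain ⟨j, hj, hj0⟩ := hz
    have : 2 ∣ ∑ i ∈ C, g i := by
      apply Finset.dvd_sum
      intro i hi
      have h1 := hb i hi j hj
      have h2 := hcon i hi
      have : g i = 0 ∨ g i = 2 := by omega
      rcases this with h | h <;> simp [h]
    omega
  · push Not at hz
    have : ∑ i ∈ C, 2 ≤ ∑ i ∈ C, g i := by
      apply Finset.sum_le_sum
      intro i hi
      have h1 := hz i hi
      have h2 := hcon i hi
      omega
    simp at this
    omega

lemma extend_col {V : Type*} [Fintype V] : ∀ (n : ℕ) (K : SimpleGraph V) (C : Finset ℕ)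
    (N : Finset V) (c : V → V → ℕ) (A : V → Finset ℕ) (w0 : V), N.card = n → PropCol K C c →
    (∀ w ∈ N, A w ⊆ C) → (∀ w ∈ N, ∀ y, K.Adj w y → c w y ∉ A w) →
    (∀ w ∈ N, 1 ≤ (A w).card) → (∀ w ∈ N, w ≠ w0 → 2 ≤ (A w).card) → N.card ≤ C.card →
    ∃ (c' : V → V → ℕ) (f : V → ℕ), PropCol K C c' ∧ (∀ w ∈ N, f w ∈ C) ∧
      (∀ w ∈ N, ∀ z ∈ N, f w = f z → w = z) ∧ (∀ w ∈ N, ∀ y, K.Adj w y → c' w y ≠ f w) := by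
  intro n
  induction n with
  | zero =>
    intro K C N c A w0 hN hc _ _ _ _ _
    rw [Finset.card_eq_zero] at hN
    subst hN
    exact ⟨c, fun _ => 0, hc, by simp, by simp, by simp⟩
  | succ n ih =>
    intro K C N c A w0 hN hc hsub hmiss h1 h2 hcard
    obtain ⟨w1, hw1, hw1'⟩ : ∃ w1 ∈ N, ∀ w ∈ N, w ≠ w1 → 2 ≤ (A w).card := by
      by_cases hw : w0 ∈ N
      · exact ⟨w0, hw, h2⟩
      · obtain ⟨w1, hw1⟩ : N.Nonempty := by
          rw [← Finset.card_pos]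
          omega
        exact ⟨w1, hw1, fun w hwN _ => h2 w hwN (fun he => hw (he ▸ hwN))⟩
    let s : V → ℕ := fun w => if w = w1 then 1 else 2
    have hex : ∀ w, ∃ B : Finset ℕ, w ∈ N → B ⊆ A w ∧ B.card = s w := by
      intro w
      by_cases hw : w ∈ N
      · have : s w ≤ (A w).card := by
          by_cases hww : w = w1
          · simpa [s, hww] using h1 w1 hw1
          · simpa [s, hww] using hw1' w hw hww
        obtain ⟨B, hB⟩ := Finset.exists_subset_card_eq this
        exact ⟨B, fun _ => hB⟩
      · exact ⟨∅, fun hh => absurd hh hw⟩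
    choose A0 hA0 using hex
    have hst : ∃ k c A, State K C N s c A ∧ pot C N A = k :=
      ⟨_, c, A0, ⟨hc, fun w hw => (hA0 w hw).1.trans (hsub w hw),
        fun w hw y hy hm => hmiss w hw y hy ((hA0 w hw).1 hm), fun w hw => (hA0 w hw).2⟩, rfl⟩
    obtain ⟨c1, A1, hS, hpot⟩ := Nat.find_spec hst
    have hmin : ∀ c' A', State K C N s c' A' → pot C N A1 ≤ pot C N A' := by
      intro c' A' hS'
      rw [hpot]
      exact Nat.find_min' hst ⟨c', A', hS', rfl⟩
    have hsum : ∑ i ∈ C, (N.filter (fun w => i ∈ A1 w)).card + 1 = 2 * N.card := by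
      have e1 := Finset.sum_card_bipartiteAbove_eq_sum_card_bipartiteBelow
        (s := C) (t := N) (fun i w => i ∈ A1 w)
      simp only [Finset.bipartiteAbove, Finset.bipartiteBelow] at e1
      rw [e1]
      have e2 : ∀ w ∈ N, (C.filter (fun i => i ∈ A1 w)).card = s w := by
        intro w hw
        rw [← hS.card w hw]
        congr 1
        ext i
        simp only [Finset.mem_filter]
        exact ⟨fun h => h.2, fun h => ⟨hS.sub w hw h, h⟩⟩
      rw [Finset.sum_congr rfl e2, ← Finset.add_sum_erase N _ hw1]
      have e3 : ∀ w ∈ N.erase w1, s w = 2 := by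
        intro w hw
        simp [s, (Finset.mem_erase.1 hw).1]
      rw [Finset.sum_congr rfl e3]
      simp [s, Finset.card_erase_of_mem hw1]
      omega
    obtain ⟨i, hi, hi1⟩ := odd_claim C (fun i => (N.filter (fun w => i ∈ A1 w)).card) N.card hcard
      hsum (by
        intro i hi j hj
        by_contra hcon
        push Not at hcon
        obtain ⟨c', A', hS', hlt⟩ := swap_step K C N s c1 A1 hS i j hi hj hcon
        have := hmin c' A' hS'
        omega)
    obtain ⟨u, hu⟩ := Finset.card_eq_one.1 hi1
    have huN : u ∈ N ∧ i ∈ A1 u := by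
      have : u ∈ N.filter (fun w => i ∈ A1 w) := by rw [hu]; simp
      simpa using this
    have hother : ∀ w ∈ N, w ≠ u → i ∉ A1 w := by
      intro w hw hne hm
      have : w ∈ N.filter (fun w => i ∈ A1 w) := by simp [hw, hm]
      rw [hu] at this
      exact hne (by simpa using this)
    let K' : SimpleGraph V :=
      { Adj := fun x y => K.Adj x y ∧ c1 x y ≠ i
        symm := ⟨fun x y h => ⟨h.1.symm, by rw [hS.col.symm y x]; exact h.2⟩⟩
        loopless := ⟨fun x h => K.loopless.irrefl x h.1⟩ }
    obtain ⟨c2, f2, hc2, hf2, hinj2, hm2⟩ := ih K' (C.erase i) (N.erase u) c1 A1 w1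
      (by rw [Finset.card_erase_of_mem huN.1]; omega)
      ⟨hS.col.symm, fun x y h => Finset.mem_erase.2 ⟨h.2, hS.col.mem x y h.1⟩,
        fun x y z hy hz he => hS.col.inj x y z hy.1 hz.1 he⟩
      (by
        intro w hw a ha
        have hw' := Finset.mem_erase.1 hw
        refine Finset.mem_erase.2 ⟨?_, hS.sub w hw'.2 ha⟩
        rintro rfl
        exact hother w hw'.2 hw'.1 ha)
      (fun w hw y hy => hS.miss w (Finset.mem_of_mem_erase hw) y hy.1)
      (by
        intro w hw
        rw [hS.card w (Finset.mem_of_mem_erase hw)]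
        simp only [s]
        split_ifs <;> omega)
      (by
        intro w hw hne
        rw [hS.card w (Finset.mem_of_mem_erase hw)]
        simp [s, hne])
      (by rw [Finset.card_erase_of_mem huN.1, Finset.card_erase_of_mem hi]; omega)
    let c3 : V → V → ℕ := fun x y => if K.Adj x y ∧ c1 x y = i then i else c2 x y
    have hc3 : ∀ x y, K.Adj x y → (c1 x y = i ∧ c3 x y = i) ∨
        (K'.Adj x y ∧ c3 x y = c2 x y ∧ c2 x y ≠ i) := by
      intro x y hxy
      by_cases hh : c1 x y = i
      · left
        simp [c3, hxy, hh]
      · right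
        refine ⟨⟨hxy, hh⟩, by simp [c3, hh], ?_⟩
        exact (Finset.mem_erase.1 (hc2.mem x y ⟨hxy, hh⟩)).1
    refine ⟨c3, fun w => if w = u then i else f2 w, ⟨?_, ?_, ?_⟩, ?_, ?_, ?_⟩
    · intro x y
      simp only [c3, hS.col.symm x y, hc2.symm x y, K.adj_comm x y]
    · intro x y hxy
      rcases hc3 x y hxy with ⟨_, h⟩ | ⟨h', h, _⟩
      · rwa [h]
      · rw [h]
        exact Finset.mem_of_mem_erase (hc2.mem x y h')
    · intro x y z hxy hxz he
      rcases hc3 x y hxy with ⟨a1, a2⟩ | ⟨a1, a2, a3⟩ <;>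
        rcases hc3 x z hxz with ⟨b1, b2⟩ | ⟨b1, b2, b3⟩
      · exact hS.col.inj x y z hxy hxz (a1.trans b1.symm)
      · exact absurd (by rw [← b2, ← he, a2]) b3
      · exact absurd (by rw [← a2, he, b2]) a3
      · exact hc2.inj x y z a1 b1 (by rw [← a2, ← b2, he])
    · intro w hw
      dsimp only
      split_ifs with h
      · exact hi
      · exact Finset.mem_of_mem_erase (hf2 w (Finset.mem_erase.2 ⟨h, hw⟩))
    · intro w hw z hz he
      dsimp only at he
      split_ifs at he with a b b
      · rw [a, b]
      · exact absurd he.symm (Finset.mem_erase.1 (hf2 z (Finset.mem_erase.2 ⟨b, hz⟩))).1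
      · exact absurd he (Finset.mem_erase.1 (hf2 w (Finset.mem_erase.2 ⟨a, hw⟩))).1
      · exact hinj2 w (Finset.mem_erase.2 ⟨a, hw⟩) z (Finset.mem_erase.2 ⟨b, hz⟩) he
    · intro w hw y hy
      dsimp only
      split_ifs with a
      · subst a
        rcases hc3 w y hy with ⟨a1, _⟩ | ⟨_, a2, a3⟩
        · exact absurd huN.2 (a1 ▸ hS.miss w hw y hy)
        · rwa [a2]
      · have hw' := Finset.mem_erase.2 ⟨a, hw⟩
        rcases hc3 w y hy with ⟨_, a2⟩ | ⟨a1, a2, _⟩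
        · rw [a2]
          exact (Finset.mem_erase.1 (hf2 w hw')).1.symm
        · rw [a2]
          exact hm2 w hw' y a1

/-- The part of `G` inside `S`. -/
def inside {V : Type*} (G : SimpleGraph V) (S : Finset V) : SimpleGraph V where
  Adj x y := G.Adj x y ∧ x ∈ S ∧ y ∈ S
  symm := ⟨fun _ _ h => ⟨h.1.symm, h.2.2, h.2.1⟩⟩
  loopless := ⟨fun x h => G.loopless.irrefl x h.1⟩

/-- The theorem of Vizing. -/
lemma vizing {V : Type*} [Fintype V] (G : SimpleGraph V) (D : ℕ) (hD : ∀ v, G.degree v ≤ D)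
    (S : Finset V) : ∃ c, PropCol (inside G S) (Finset.range (D + 1)) c := by
  induction S using Finset.induction_on with
  | empty => exact ⟨fun _ _ => 0, fun _ _ => rfl, fun x y h => by simp [inside] at h,
      fun x y z h => by simp [inside] at h⟩
  | insert v S hv ih =>
    obtain ⟨c, hc⟩ := ih
    let N : Finset V := S.filter (fun w => G.Adj v w)
    let A : V → Finset ℕ := fun w =>
      Finset.range (D + 1) \ ((inside G S).neighborFinset w).image (c w)
    have hNcard : N.card ≤ D := by
      refine le_trans (Finset.card_le_card ?_) (hD v)
      intro w hw
      simpa using (Finset.mem_filter.1 hw).2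
    have hA : ∀ w ∈ N, 2 ≤ (A w).card := by
      intro w hw
      have hw' := Finset.mem_filter.1 hw
      have e1 : ((inside G S).neighborFinset w).card + 1 ≤ D := by
        refine le_trans ?_ (hD w)
        rw [← Finset.card_insert_of_notMem (a := v) (by
            rw [SimpleGraph.mem_neighborFinset]
            exact fun h => hv h.2.2),
          ← SimpleGraph.card_neighborFinset_eq_degree]
        apply Finset.card_le_card
        intro y hy
        rcases Finset.mem_insert.1 hy with rfl | hy
        · simpa using hw'.2.symm
        · have : (inside G S).Adj w y := by simpa using hy
          simpa using this.1
      have e2 := Finset.le_card_sdiff (((inside G S).neighborFinset w).image (c w))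
        (Finset.range (D + 1))
      have e3 := Finset.card_image_le (s := (inside G S).neighborFinset w) (f := c w)
      rw [Finset.card_range] at e2
      change _ ≤ (A w).card at e2
      omega
    obtain ⟨c', f, hc', hf, hfi, hfm⟩ := extend_col N.card (inside G S) (Finset.range (D + 1)) N c A v
      rfl hc (fun w _ => Finset.sdiff_subset)
      (by
        intro w _ y hy hm
        apply (Finset.mem_sdiff.1 hm).2
        exact Finset.mem_image.2 ⟨y, by simpa using hy, rfl⟩)
      (fun w hw => le_trans (by norm_num) (hA w hw)) (fun w hw _ => hA w hw)
      (by rw [Finset.card_range]; omega)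
    let c3 : V → V → ℕ := fun x y => if x = v then f y else if y = v then f x else c' x y
    have hvx : ∀ y, (inside G (insert v S)).Adj v y → y ∈ N ∧ c3 v y = f y := by
      intro y hy
      refine ⟨Finset.mem_filter.2 ⟨?_, hy.1⟩, by simp [c3]⟩
      rcases Finset.mem_insert.1 hy.2.2 with h | h
      · exact absurd (h ▸ hy.1) (G.loopless.irrefl v)
      · exact h
    have hxv : ∀ x y, x ≠ v → (inside G (insert v S)).Adj x y →
        (y = v ∧ x ∈ N ∧ c3 x y = f x) ∨ ((inside G S).Adj x y ∧ c3 x y = c' x y) := by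
      intro x y hx hxy
      by_cases hy : y = v
      · subst hy
        left
        exact ⟨rfl, (hvx x hxy.symm).1, by simp [c3, hx]⟩
      · right
        refine ⟨⟨hxy.1, ?_, ?_⟩, by simp [c3, hx, hy]⟩
        · exact (Finset.mem_insert.1 hxy.2.1).resolve_left hx
        · exact (Finset.mem_insert.1 hxy.2.2).resolve_left hy
    refine ⟨c3, ?_, ?_, ?_⟩
    · intro x y
      by_cases hx : x = v <;> by_cases hy : y = v <;> simp [c3, hx, hy, hc'.symm x y]
    · intro x y hxy
      by_cases hx : x = v
      · subst hx
        rw [(hvx y hxy).2]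
        exact hf y (hvx y hxy).1
      · rcases hxv x y hx hxy with ⟨_, h1, h2⟩ | ⟨h1, h2⟩
        · rw [h2]
          exact hf x h1
        · rw [h2]
          exact hc'.mem x y h1
    · intro x y z hxy hxz he
      by_cases hx : x = v
      · subst hx
        rw [(hvx y hxy).2, (hvx z hxz).2] at he
        exact hfi y (hvx y hxy).1 z (hvx z hxz).1 he
      · rcases hxv x y hx hxy with ⟨a1, a2, a3⟩ | ⟨a1, a2⟩ <;>
          rcases hxv x z hx hxz with ⟨b1, b2, b3⟩ | ⟨b1, b2⟩
        · rw [a1, b1]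
        · exact absurd (by rw [← b2, ← he, a3]) (hfm x a2 z b1)
        · exact absurd (by rw [← a2, he, b3]) (hfm x b2 y a1)
        · exact hc'.inj x y z a1 b1 (by rw [← a2, ← b2, he])

theorem stmt_1 {V : Type*} [Fintype V] (H : SimpleGraph V) (m : ℕ) (hm : 0 < m)
    (hme : m ≤ H.edgeFinset.card) :
    ∃ H' : SimpleGraph V, H' ≤ H ∧ H'.edgeFinset.card = m ∧
      H'.maxDegree - H'.minDegree ≤ H.maxDegree - H.minDegree + 2 := by
  obtain ⟨c, hc0⟩ := vizing H H.maxDegree (fun v => H.degree_le_maxDegree v) Finset.univ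
  have hc : PropCol H (Finset.range (H.maxDegree + 1)) c :=
    ⟨hc0.symm, fun x y h => hc0.mem x y ⟨h, by simp, by simp⟩,
      fun x y z h h' => hc0.inj x y z ⟨h, by simp, by simp⟩ ⟨h', by simp, by simp⟩⟩
  set D := H.maxDegree with hDdef
  let col : Sym2 V → ℕ := Sym2.lift ⟨c, hc.symm⟩
  have hcol : ∀ x y, col s(x, y) = c x y := fun x y => rfl
  let F : ℕ → Finset (Sym2 V) := fun k => H.edgeFinset.filter (fun e => col e < k)
  have hFD : F (D + 1) = H.edgeFinset := by
    apply Finset.filter_true_of_mem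
    intro e
    induction e using Sym2.ind with
    | _ x y =>
      intro he
      rw [hcol]
      exact Finset.mem_range.1 (hc.mem x y (by simpa using he))
  have hex : ∃ k, m ≤ (F k).card := ⟨D + 1, by rw [hFD]; exact hme⟩
  obtain ⟨k, hk1, hk2, hkD⟩ : ∃ k, (F k).card ≤ m ∧ m ≤ (F (k + 1)).card ∧ k ≤ D := by
    have hs := Nat.find_spec hex
    have hle : Nat.find hex ≤ D + 1 := Nat.find_min' hex (by rw [hFD]; exact hme)
    rcases hn : Nat.find hex with _ | k
    · rw [hn] at hs
      simp [F] at hs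
      omega
    · rw [hn] at hs
      have := Nat.find_min hex (m := k) (by omega)
      exact ⟨k, by omega, hs, by omega⟩
  have hFF : F k ⊆ F (k + 1) := by
    intro e he
    simp only [F, Finset.mem_filter] at he ⊢
    exact ⟨he.1, by omega⟩
  obtain ⟨T, hT1, hT2, hTm⟩ := Finset.exists_subsuperset_card_eq hFF hk1 hk2
  have hTH : T ⊆ H.edgeFinset := hT2.trans (Finset.filter_subset _ _)
  obtain ⟨H', hadj⟩ : ∃ H' : SimpleGraph V, ∀ x y, H'.Adj x y ↔ s(x, y) ∈ T := by
    refine ⟨SimpleGraph.fromEdgeSet (T : Set (Sym2 V)), ?_⟩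
    intro x y
    simp only [SimpleGraph.fromEdgeSet_adj, Finset.mem_coe]
    refine ⟨fun h => h.1, fun h => ⟨h, ?_⟩⟩
    have : H.Adj x y := by simpa using hTH h
    exact this.ne
  have hle : H' ≤ H := by
    intro x y h
    simpa using hTH ((hadj x y).1 h)
  have hedge : H'.edgeFinset = T := by
    ext e
    induction e using Sym2.ind with
    | _ x y => simpa using hadj x y
  refine ⟨H', hle, by rw [hedge, hTm], ?_⟩
  have hmax : H'.maxDegree ≤ k + 1 := by
    apply SimpleGraph.maxDegree_le_of_forall_degree_le
    intro v
    rw [← SimpleGraph.card_neighborFinset_eq_degree]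
    have : (H'.neighborFinset v).card ≤ (Finset.range (k + 1)).card := by
      apply Finset.card_le_card_of_injOn (fun y => c v y)
      · intro y hy
        have hy' : H'.Adj v y := by simpa using hy
        have := (Finset.mem_filter.1 (hT2 ((hadj v y).1 hy'))).2
        rw [hcol] at this
        simpa using this
      · intro y hy z hz he
        have hy' : H'.Adj v y := by simpa using hy
        have hz' : H'.Adj v z := by simpa using hz
        exact hc.inj v y z (hle hy') (hle hz') he
    simpa using this
  have hne : Nonempty V := by
    by_contra hcon
    rw [not_nonempty_iff] at hcon
    have : H.edgeFinset.card = 0 := by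
      rw [Finset.card_eq_zero, Finset.eq_empty_iff_forall_notMem]
      intro e
      induction e using Sym2.ind with
      | _ x y => exact hcon.elim x
    omega
  obtain ⟨v, hv⟩ := H'.exists_minimal_degree_vertex
  have hmin : H.degree v + k ≤ H'.degree v + (D + 1) := by
    rw [← SimpleGraph.card_neighborFinset_eq_degree, ← SimpleGraph.card_neighborFinset_eq_degree,
      ← Finset.card_filter_add_card_filter_not (s := H.neighborFinset v) (fun y => c v y < k)]
    have e1 : ((H.neighborFinset v).filter (fun y => c v y < k)).card ≤ (H'.neighborFinset v).card := by
      apply Finset.card_le_card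
      intro y hy
      simp only [Finset.mem_filter, SimpleGraph.mem_neighborFinset] at hy ⊢
      rw [hadj]
      apply hT1
      simp only [F, Finset.mem_filter, hcol]
      exact ⟨by simpa using hy.1, hy.2⟩
    have e2 : ((H.neighborFinset v).filter (fun y => ¬ c v y < k)).card
        ≤ (Finset.Ico k (D + 1)).card := by
      apply Finset.card_le_card_of_injOn (fun y => c v y)
      · intro y hy
        simp only [Finset.coe_filter, SimpleGraph.mem_neighborFinset, Set.mem_ofPred_eq] at hy
        have := Finset.mem_range.1 (hc.mem v y hy.1)
        simp only [Finset.coe_Ico, Set.mem_Ico]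
        omega
      · intro y hy z hz he
        simp only [Finset.coe_filter, SimpleGraph.mem_neighborFinset, Set.mem_ofPred_eq] at hy hz
        exact hc.inj v y z hy.1 hz.1 he
    rw [Nat.card_Ico] at e2
    omega
  have h1 := H.minDegree_le_degree v
  have h2 := H.degree_le_maxDegree v
  rw [← hDdef] at h2
  omega
end

section
/- There exists d₀ such that for all d ≥ d₀ the following holds. Let n ≥ d+1 be an even integer and let G be an (n,d,λ)-graph with λ ≤ d/12. Then the edge set of G can be partitioned into at most log₂ d + 36 spanning subgraphs, each of which is regular and bipartite. -/
open scoped Classical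

/-- Independence for counting. -/
lemma count_indep {ι C : Type} [DecidableEq ι] [Fintype ι] [Fintype C] (T : Finset ι)
    (B D : (ι → C) → Prop)
    (hB : ∀ σ τ : ι → C, (∀ x ∈ T, σ x = τ x) → B σ → B τ)
    (hD : ∀ σ τ : ι → C, (∀ x, x ∉ T → σ x = τ x) → D σ → D τ) :
    (Finset.univ.filter (fun σ => B σ ∧ D σ)).card * Fintype.card (ι → C)
      = (Finset.univ.filter B).card * (Finset.univ.filter D).card := by
  rw [← Finset.card_univ, ← Finset.card_product, ← Finset.card_product]
  let sw : (ι → C) × (ι → C) → (ι → C) × (ι → C) := fun p =>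
    (fun x => if x ∈ T then p.1 x else p.2 x, fun x => if x ∈ T then p.2 x else p.1 x)
  have hsw : ∀ p, sw (sw p) = p := by
    intro p
    ext x <;> by_cases hx : x ∈ T <;> simp [sw, hx]
  refine Finset.card_bij' (fun p _ => sw p) (fun p _ => sw p) ?_ ?_ (fun p _ => hsw p)
    (fun p _ => hsw p)
  · rintro ⟨σ, τ⟩ h
    simp only [Finset.mem_product, Finset.mem_filter, Finset.mem_univ, true_and, and_true] at h ⊢
    refine ⟨hB σ _ ?_ h.1, hD σ _ ?_ h.2⟩ <;> intro x hx <;> simp [sw, hx]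
  · rintro ⟨σ, τ⟩ h
    simp only [Finset.mem_product, Finset.mem_filter, Finset.mem_univ, true_and, and_true] at h ⊢
    refine ⟨hB σ _ ?_ h.1, hD τ _ ?_ h.2⟩ <;> intro x hx <;> simp [sw, hx]

/-- A local lemma (Rosenfeld counting form). -/
lemma local_lemma {ι C I : Type} [DecidableEq ι] [Fintype ι] [Fintype C] [Nonempty C] [Fintype I]
    (T : I → Finset ι) (B : I → (ι → C) → Prop)
    (hT : ∀ i, (T i).Nonempty)
    (hB : ∀ i, ∀ σ τ : ι → C, (∀ x ∈ T i, σ x = τ x) → B i σ → B i τ)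
    (p : I → ℝ) (η : ℝ) (hη0 : 0 ≤ η) (hη1 : η < 1)
    (hp : ∀ i, ((Finset.univ.filter (B i)).card : ℝ) ≤ p i * Fintype.card (ι → C))
    (hsum : ∀ x, ∑ i ∈ Finset.univ.filter (fun i => x ∈ T i), p i / (1 - η) ^ (T i).card ≤ η) :
    ∃ σ : ι → C, ∀ i, ¬ B i σ := by
  set N : ℝ := ((Fintype.card (ι → C) : ℕ) : ℝ) with hN
  have hNpos : 0 < N := by
    rw [hN]; exact_mod_cast Fintype.card_pos
  have h1 : 0 < 1 - η := by linarith
  have h1' : 1 - η ≤ 1 := by linarith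
  have hp0 : ∀ i, 0 ≤ p i := by
    intro i
    by_contra h
    push Not at h
    have := hp i
    have h2 : (0:ℝ) ≤ ((Finset.univ.filter (B i)).card : ℝ) := by positivity
    nlinarith
  let good : Finset ι → (ι → C) → Prop := fun S σ => ∀ i, T i ⊆ S → ¬ B i σ
  let P : Finset ι → ℝ := fun S => ((Finset.univ.filter (good S)).card : ℝ)
  have hPmono : ∀ S S', S ⊆ S' → P S' ≤ P S := by
    intro S S' h
    simp only [P]
    norm_cast
    apply Finset.card_le_card
    intro σ
    simp only [Finset.mem_filter, Finset.mem_univ, true_and, good]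
    intro h2 i hi
    exact h2 i (hi.trans h)
  have hP0 : ∀ S, 0 ≤ P S := fun S => by positivity
  -- main claim
  have key : ∀ k : ℕ, ∀ S : Finset ι, S.card = k → ∀ v, v ∉ S → (1 - η) * P S ≤ P (insert v S) := by
    intro k
    induction k using Nat.strong_induction_on with
    | _ k ih =>
      intro S hS v hv
      -- removing a set
      have hrem : ∀ m : ℕ, ∀ R : Finset ι, R ⊆ S → R.card = m → (1 - η) ^ m * P (S \ R) ≤ P S := by
        intro m
        induction m with
        | zero =>
          intro R _ hR
          have : R = ∅ := Finset.card_eq_zero.mp hR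
          simp [this]
        | succ m ihm =>
          intro R hRS hR
          obtain ⟨x, R', hx, rfl, hR'⟩ := Finset.card_eq_succ.mp hR
          have hxS : x ∈ S := hRS (Finset.mem_insert_self _ _)
          have e1 := ihm R' ((Finset.subset_insert _ _).trans hRS) hR'
          have e2 := ih (S \ insert x R').card (by
            rw [← hS]
            apply Finset.card_lt_card
            refine ⟨Finset.sdiff_subset, fun h => ?_⟩
            have := h hxS
            simp at this) (S \ insert x R') rfl x (by simp)
          have e3 : insert x (S \ insert x R') = S \ R' := by
            ext y
            simp only [Finset.mem_insert, Finset.mem_sdiff]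
            by_cases hy : y = x
            · subst hy; simp [hxS, hx]
            · simp [hy]
          rw [e3] at e2
          calc (1 - η) ^ (m + 1) * P (S \ insert x R')
              = (1 - η) ^ m * ((1 - η) * P (S \ insert x R')) := by ring
            _ ≤ (1 - η) ^ m * P (S \ R') := by
                apply mul_le_mul_of_nonneg_left e2; positivity
            _ ≤ P S := e1
      -- union bound
      have hunion : P S ≤ P (insert v S) + ∑ i ∈ Finset.univ.filter (fun i => v ∈ T i ∧ T i ⊆ insert v S),
          ((Finset.univ.filter (fun σ => B i σ ∧ good (S \ T i) σ)).card : ℝ) := by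
        simp only [P]
        norm_cast
        refine le_trans (Finset.card_le_card ?_) ((Finset.card_union_le _ _).trans
          (Nat.add_le_add_left (Finset.card_biUnion_le (s := Finset.univ.filter (fun i => v ∈ T i ∧ T i ⊆ insert v S)) (t := fun i => Finset.univ.filter (fun σ => B i σ ∧ good (S \ T i) σ))) _))
        intro σ hσ
        simp only [Finset.mem_filter, Finset.mem_univ, true_and, Finset.mem_union,
          Finset.mem_biUnion] at hσ ⊢
        by_cases hg : good (insert v S) σ
        · exact Or.inl hg
        · right
          simp only [good, not_forall, not_not] at hg
          obtain ⟨i, hi, hBi⟩ := hg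
          refine ⟨i, ⟨?_, hi⟩, hBi, ?_⟩
          · by_contra hvi
            refine hσ i ?_ hBi
            intro y hy
            have := hi hy
            rw [Finset.mem_insert] at this
            rcases this with rfl | h
            · exact absurd hy hvi
            · exact h
          · intro i' hi'
            exact hσ i' (hi'.trans Finset.sdiff_subset)
      have hterm : ∀ i ∈ Finset.univ.filter (fun i => v ∈ T i ∧ T i ⊆ insert v S),
          ((Finset.univ.filter (fun σ => B i σ ∧ good (S \ T i) σ)).card : ℝ)
            ≤ p i / (1 - η) ^ (T i).card * P S := by
        intro i hi
        simp only [Finset.mem_filter, Finset.mem_univ, true_and] at hi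
        have hind := count_indep (T i) (B i) (good (S \ T i)) (hB i) (by
          intro σ τ h hσ i' hi' hb
          refine hσ i' hi' (hB i' τ σ ?_ hb)
          intro x hx
          have := hi' hx
          rw [Finset.mem_sdiff] at this
          exact (h x this.2).symm)
        have hind' : ((Finset.univ.filter (fun σ => B i σ ∧ good (S \ T i) σ)).card : ℝ) * N
            = ((Finset.univ.filter (B i)).card : ℝ) * P (S \ T i) := by
          simp only [P, hN]
          have hc := congrArg (Nat.cast : ℕ → ℝ) hind
          rw [Nat.cast_mul, Nat.cast_mul] at hc
          convert hc <;> rfl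
        have hr := hrem _ (S ∩ T i) Finset.inter_subset_left rfl
        have e4 : S \ (S ∩ T i) = S \ T i := by simp
        rw [e4] at hr
        have hpow : (1 - η) ^ (T i).card ≤ (1 - η) ^ (S ∩ T i).card :=
          pow_le_pow_of_le_one h1.le h1' (Finset.card_le_card Finset.inter_subset_right)
        have hpp : 0 < (1 - η) ^ (T i).card := by positivity
        have hP' : (1 - η) ^ (T i).card * P (S \ T i) ≤ P S :=
          (mul_le_mul_of_nonneg_right hpow (hP0 _)).trans hr
        have hP'' : P (S \ T i) ≤ P S / (1 - η) ^ (T i).card := by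
          rw [le_div_iff₀ hpp]; linarith
        have : ((Finset.univ.filter (fun σ => B i σ ∧ good (S \ T i) σ)).card : ℝ) * N
            ≤ (p i / (1 - η) ^ (T i).card * P S) * N := by
          rw [hind']
          calc ((Finset.univ.filter (B i)).card : ℝ) * P (S \ T i)
              ≤ (p i * N) * (P S / (1 - η) ^ (T i).card) := by
                apply mul_le_mul (hp i) hP'' (hP0 _)
                exact mul_nonneg (hp0 i) hNpos.le
            _ = _ := by ring
        exact le_of_mul_le_mul_right this hNpos
      have hs := Finset.sum_le_sum hterm
      rw [← Finset.sum_mul] at hs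
      have hs2 : ∑ i ∈ Finset.univ.filter (fun i => v ∈ T i ∧ T i ⊆ insert v S), p i / (1 - η) ^ (T i).card ≤ η := by
        refine le_trans (Finset.sum_le_sum_of_subset_of_nonneg ?_ ?_) (hsum v)
        · intro i; simp only [Finset.mem_filter, Finset.mem_univ, true_and]; exact fun h => h.1
        · intro i _ _; have := hp0 i; positivity
      nlinarith [hP0 S, mul_le_mul_of_nonneg_right hs2 (hP0 S)]
  have hall : ∀ S : Finset ι, 0 < P S := by
    intro S
    induction S using Finset.induction_on with
    | empty =>
      have : Finset.univ.filter (good ∅) = Finset.univ := by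
        ext σ
        simp only [Finset.mem_filter, Finset.mem_univ, true_and, good, iff_true]
        intro i hi
        exact absurd (Finset.subset_empty.mp hi) (hT i).ne_empty
      simp only [P, this]
      rw [Finset.card_univ]; exact hNpos
    | insert v S hv ihS =>
      have := key _ S rfl v hv
      have h3 : 0 < (1 - η) * P S := mul_pos h1 ihS
      linarith
  have hfin := hall Finset.univ
  simp only [P] at hfin
  have hc : 0 < (Finset.univ.filter (good Finset.univ)).card := by exact_mod_cast hfin
  obtain ⟨σ, hσ⟩ := Finset.card_pos.mp hc
  simp only [Finset.mem_filter, Finset.mem_univ, true_and, good] at hσ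
  exact ⟨σ, fun i => hσ i (Finset.subset_univ _)⟩

/-- Exponential-moment concentration, in counting form. -/
lemma count_tail {ι C : Type} [DecidableEq ι] [Fintype ι] [Fintype C] [Nonempty C] (T : Finset ι)
    (Z : ι → C → ℝ) (hZ : ∀ x c, |Z x c| ≤ 2) (hZ0 : ∀ x, ∑ c, Z x c = 0)
    (a D : ℝ) (hD : 0 < D) (hT : (T.card : ℝ) ≤ D) (ha : 0 ≤ a) (haD : a ≤ 4 * D) :
    ((Finset.univ.filter (fun σ : ι → C => a ≤ ∑ x ∈ T, Z x (σ x))).card : ℝ)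
      ≤ Real.exp (-(a ^ 2 / (16 * D))) * Fintype.card (ι → C) := by
  set θ : ℝ := a / (8 * D) with hθ
  have hθ0 : 0 ≤ θ := by positivity
  have hθ1 : 2 * θ ≤ 1 := by
    rw [hθ, ← mul_div_assoc, div_le_one (by positivity)]; linarith
  set q : ℝ := ((Fintype.card C : ℕ) : ℝ) with hq
  have hq0 : 0 < q := by rw [hq]; exact_mod_cast Fintype.card_pos
  have hone : ∀ x, ∑ c, Real.exp (θ * Z x c) ≤ q * Real.exp (4 * θ ^ 2) := by
    intro x
    have h1 : ∀ c, Real.exp (θ * Z x c) ≤ 1 + θ * Z x c + 4 * θ ^ 2 := by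
      intro c
      have hz := hZ x c
      have habs : |θ * Z x c| ≤ 1 := by
        rw [abs_mul, abs_of_nonneg hθ0]
        nlinarith
      have h2 := Real.abs_exp_sub_one_sub_id_le habs
      have h3 := (abs_le.mp h2).2
      have h4 : (θ * Z x c) ^ 2 ≤ 4 * θ ^ 2 := by
        have : (Z x c) ^ 2 ≤ 4 := by
          rw [← sq_abs]; nlinarith [abs_nonneg (Z x c)]
        nlinarith [sq_nonneg θ]
      linarith
    calc ∑ c, Real.exp (θ * Z x c) ≤ ∑ c, (1 + θ * Z x c + 4 * θ ^ 2) :=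
          Finset.sum_le_sum fun c _ => h1 c
      _ = q * (4 * θ ^ 2 + 1) := by
          rw [Finset.sum_add_distrib, Finset.sum_add_distrib, ← Finset.mul_sum, hZ0]
          simp [hq]; ring
      _ ≤ q * Real.exp (4 * θ ^ 2) := by
          apply mul_le_mul_of_nonneg_left (Real.add_one_le_exp _) hq0.le
  have hprod : ∑ σ : ι → C, Real.exp (θ * ∑ x ∈ T, Z x (σ x))
      ≤ Fintype.card (ι → C) * Real.exp (4 * θ ^ 2 * D) := by
    have e1 : ∀ σ : ι → C, Real.exp (θ * ∑ x ∈ T, Z x (σ x))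
        = ∏ x, (if x ∈ T then Real.exp (θ * Z x (σ x)) else 1) := by
      intro σ
      rw [Finset.mul_sum, Real.exp_sum, Finset.prod_ite_mem, Finset.univ_inter]
    simp_rw [e1]
    rw [← Fintype.prod_sum (fun x c => if x ∈ T then Real.exp (θ * Z x c) else 1)]
    calc ∏ x, ∑ c, (if x ∈ T then Real.exp (θ * Z x c) else 1)
        ≤ ∏ x : ι, (q * (if x ∈ T then Real.exp (4 * θ ^ 2) else 1)) := by
          apply Finset.prod_le_prod
          · intro x _
            apply Finset.sum_nonneg
            intro c _
            split_ifs <;> positivity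
          · intro x _
            by_cases hx : x ∈ T
            · simp only [hx, if_true]; exact hone x
            · simp [hx, hq]
      _ = q ^ Fintype.card ι * Real.exp (4 * θ ^ 2) ^ T.card := by
          rw [Finset.prod_mul_distrib, Finset.prod_ite_mem, Finset.univ_inter]
          simp
      _ ≤ _ := by
          rw [Fintype.card_fun, ← Real.exp_nat_mul]
          push_cast
          apply mul_le_mul_of_nonneg_left _ (by positivity)
          apply Real.exp_le_exp.mpr
          nlinarith [sq_nonneg θ]
  have hmark : ((Finset.univ.filter (fun σ : ι → C => a ≤ ∑ x ∈ T, Z x (σ x))).card : ℝ)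
      * Real.exp (θ * a) ≤ ∑ σ : ι → C, Real.exp (θ * ∑ x ∈ T, Z x (σ x)) := by
    rw [← nsmul_eq_mul, ← Finset.sum_const]
    refine le_trans (Finset.sum_le_sum ?_) (Finset.sum_le_sum_of_subset_of_nonneg
      (Finset.filter_subset _ _) (fun _ _ _ => (Real.exp_pos _).le))
    intro σ hσ
    simp only [Finset.mem_filter, Finset.mem_univ, true_and] at hσ
    apply Real.exp_le_exp.mpr
    exact mul_le_mul_of_nonneg_left hσ hθ0
  have h5 := hmark.trans hprod
  have h6 : Real.exp (-(a ^ 2 / (16 * D))) = Real.exp (4 * θ ^ 2 * D) / Real.exp (θ * a) := by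
    rw [← Real.exp_sub]
    congr 1
    rw [hθ]; field_simp; ring
  rw [h6, div_mul_eq_mul_div, le_div_iff₀ (Real.exp_pos _)]
  linarith

/-- Orientation lemma via Hall. -/
lemma orient {E V : Type} [Fintype E] [Fintype V] [DecidableEq V] (s t : E → V) (cap : V → ℕ)
    (hcap : ∑ v, cap v = Fintype.card E)
    (hH : ∀ X : Finset E, X.card ≤ ∑ v ∈ X.image s ∪ X.image t, cap v) :
    ∃ o : E → V, (∀ e, o e = s e ∨ o e = t e) ∧
      ∀ v, (Finset.univ.filter (fun e => o e = v)).card = cap v := by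
  let α := Σ v : V, Fin (cap v)
  let tt : E → Finset α := fun e => Finset.univ.filter (fun z => z.1 = s e ∨ z.1 = t e)
  have hsum : ∀ W : Finset V, (Finset.univ.filter (fun z : α => z.1 ∈ W)).card = ∑ v ∈ W, cap v := by
    intro W
    have : Finset.univ.filter (fun z : α => z.1 ∈ W) = W.sigma (fun v => Finset.univ) := by
      ext z
      simp only [Finset.mem_filter, Finset.mem_univ, true_and]
      exact ⟨fun h => Finset.mem_sigma.mpr ⟨h, Finset.mem_univ _⟩, fun h => (Finset.mem_sigma.mp h).1⟩
    rw [this, Finset.card_sigma]; simp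
  obtain ⟨f, hf, hft⟩ := (Finset.all_card_le_biUnion_card_iff_exists_injective tt).mp (by
    intro X
    refine (hH X).trans ?_
    rw [← hsum]
    apply Finset.card_le_card
    intro z hz
    simp only [Finset.mem_filter, Finset.mem_univ, true_and, Finset.mem_union, Finset.mem_image,
      Finset.mem_biUnion, tt] at hz ⊢
    rcases hz with ⟨e, he, h⟩ | ⟨e, he, h⟩
    · exact ⟨e, he, Or.inl h.symm⟩
    · exact ⟨e, he, Or.inr h.symm⟩)
  refine ⟨fun e => (f e).1, fun e => ?_, ?_⟩
  · have := hft e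
    simpa [tt] using this
  have hle : ∀ v, (Finset.univ.filter (fun e => (f e).1 = v)).card ≤ cap v := by
    intro v
    have h1 := hsum {v}
    rw [Finset.sum_singleton] at h1
    rw [← h1]
    apply Finset.card_le_card_of_injOn f
    · intro e he
      simpa using he
    · exact hf.injOn
  have htot : ∑ v, (Finset.univ.filter (fun e => (f e).1 = v)).card = ∑ v, cap v := by
    rw [hcap, ← Finset.card_univ]
    exact (Finset.card_eq_sum_card_fiberwise (fun e _ => Finset.mem_univ _)).symm
  intro v
  exact (Finset.sum_eq_sum_iff_of_le (fun v _ => hle v)).mp htot v (Finset.mem_univ v)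

/-- representative of the pair containing `v`. -/
def rp {n : ℕ} (v : Fin n) : Fin n := if v < v.rev then v else v.rev

/-- complement of a bit string. -/
def cmpl {s : ℕ} (c : Fin s → Bool) : Fin s → Bool := fun i => !c i

/-- colour of `v` from colour of its representative. -/
def colf {n s : ℕ} (v : Fin n) (c : Fin s → Bool) : Fin s → Bool := if v < v.rev then c else cmpl c

lemma cmpl_cmpl {s : ℕ} (c : Fin s → Bool) : cmpl (cmpl c) = c := by
  ext i; simp [cmpl]

lemma cmpl_bij {s : ℕ} : Function.Bijective (cmpl (s := s)) :=
  Function.Involutive.bijective cmpl_cmpl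

lemma colf_bij {n s : ℕ} (v : Fin n) : Function.Bijective (colf (s := s) v) := by
  unfold colf
  split_ifs
  · exact Function.bijective_id
  · exact cmpl_bij

lemma rev_lt_iff {n : ℕ} (hn : Even n) (v : Fin n) : v.rev < v.rev.rev ↔ ¬ v < v.rev := by
  obtain ⟨m, hm⟩ := hn
  have := v.isLt
  simp only [Fin.lt_def, Fin.rev_rev, Fin.val_rev]
  omega

lemma rp_rev {n : ℕ} (hn : Even n) (v : Fin n) : rp v.rev = rp v := by
  unfold rp
  have := rev_lt_iff hn v
  by_cases h : v < v.rev
  · rw [if_pos h, if_neg (by tauto), Fin.rev_rev]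
  · rw [if_neg h, if_pos (by tauto)]

lemma colf_rev {n s : ℕ} (hn : Even n) (v : Fin n) (c : Fin s → Bool) :
    colf v.rev c = cmpl (colf v c) := by
  unfold colf
  have := rev_lt_iff hn v
  by_cases h : v < v.rev
  · rw [if_pos h, if_neg (by tauto)]
  · rw [if_neg h, if_pos (by tauto), cmpl_cmpl]

lemma eq_of_rp {n : ℕ} (u x : Fin n) (h : rp u = x) : u = x ∨ u = x.rev := by
  unfold rp at h
  split_ifs at h
  · exact Or.inl h
  · right; rw [← h, Fin.rev_rev]

lemma rp_inj {n : ℕ} (u v : Fin n) (h : rp u = rp v) : u = v ∨ u = v.rev := by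
  unfold rp at h
  split_ifs at h
  · exact Or.inl h
  · exact Or.inr h
  · right; rw [← h, Fin.rev_rev]
  · left; exact Fin.rev_injective h

lemma conc {n s : ℕ} (A : Finset (Fin n)) (h : (Fin s → Bool) → ℝ) (hh : ∀ c, |h c| ≤ 1)
    (hh0 : ∑ c, h c = 0) (a D : ℝ) (hD : 0 < D) (hA : (A.card : ℝ) ≤ D) (ha : 0 ≤ a)
    (haD : a ≤ 4 * D) :
    ((Finset.univ.filter (fun σ : Fin n → (Fin s → Bool) =>
        a ≤ ∑ u ∈ A, h (colf u (σ (rp u))))).card : ℝ)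
      ≤ Real.exp (-(a ^ 2 / (16 * D))) * Fintype.card (Fin n → (Fin s → Bool)) := by
  let Z : Fin n → (Fin s → Bool) → ℝ := fun x c => ∑ u ∈ A.filter (fun u => rp u = x), h (colf u c)
  have hfib : ∀ x : Fin n, (A.filter (fun u => rp u = x)).card ≤ 2 := by
    intro x
    refine (Finset.card_le_card (t := {x, x.rev}) ?_).trans Finset.card_le_two
    intro u hu
    simp only [Finset.mem_filter] at hu
    simpa using eq_of_rp u x hu.2
  have := count_tail (A.image rp) Z (by
      intro x c
      refine (Finset.abs_sum_le_sum_abs _ _).trans ?_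
      refine (Finset.sum_le_sum (fun u _ => hh _)).trans ?_
      simp only [Finset.sum_const, nsmul_eq_mul, mul_one]
      exact_mod_cast hfib x) (by
      intro x
      simp only [Z]
      rw [Finset.sum_comm]
      apply Finset.sum_eq_zero
      intro u _
      rw [← hh0]
      exact (colf_bij u).sum_comp h) a D hD
      (le_trans (by exact_mod_cast Finset.card_image_le) hA) ha haD
  refine le_trans (le_of_eq ?_) this
  congr 2
  apply Finset.filter_congr
  intro σ _
  have e : ∑ x ∈ A.image rp, Z x (σ x) = ∑ u ∈ A, h (colf u (σ (rp u))) := by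
    simp only [Z]
    rw [← Finset.sum_fiberwise_of_maps_to (g := rp) (t := A.image rp)
      (fun u hu => Finset.mem_image_of_mem _ hu)]
    apply Finset.sum_congr rfl
    intro x _
    apply Finset.sum_congr rfl
    intro u hu
    simp only [Finset.mem_filter] at hu
    rw [hu.2]
  rw [e]

set_option maxHeartbeats 1000000 in
lemma color_ex {n s : ℕ} (hn : Even n) (F : Fin n → Fin n → Prop) (d1 : ℝ)
    (hFsymm : ∀ u v, F u v → F v u)
    (hFd : ∀ v, ((Finset.univ.filter (fun u => F v u)).card : ℝ) ≤ d1)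
    (hF : ∀ u v, F u v → u ≠ v ∧ u ≠ v.rev)
    (d : ℕ) (hd : 0 < d) (A : Fin n → Finset (Fin n)) (hA : ∀ v, (A v).card ≤ d)
    (hAne : ∀ v, (A v).Nonempty)
    (hAu : ∀ u, (Finset.univ.filter (fun v => u ∈ A v)).card ≤ d)
    {K : Type} [Fintype K] (h : K → (Fin s → Bool) → ℝ) (hh : ∀ k c, |h k c| ≤ 1)
    (hh0 : ∀ k, ∑ c, h k c = 0) (a : ℝ) (ha : 0 ≤ a) (had : a ≤ 4 * d)
    (η : ℝ) (hη0 : 0 ≤ η) (hη1 : η < 1)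
    (hη : 4 * d1 / 2 ^ s / (1 - η) ^ 2 +
      2 * d * Fintype.card K * Real.exp (-(a ^ 2 / (16 * d))) / (1 - η) ^ d ≤ η) :
    ∃ y : Fin n → Fin s → Bool, (∀ v, y v.rev = cmpl (y v)) ∧ (∀ u v, F u v → y u ≠ y v) ∧
      ∀ v k, ∑ u ∈ A v, h k (y u) < a := by
  have h1 : 0 < 1 - η := by linarith
  have h1' : 1 - η ≤ 1 := by linarith
  let I := (Fin n × Fin n) ⊕ (Fin n × K)
  let T : I → Finset (Fin n) := Sum.elim (fun e => {rp e.1, rp e.2}) (fun e => (A e.1).image rp)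
  let B : I → (Fin n → (Fin s → Bool)) → Prop := Sum.elim
    (fun e σ => F e.1 e.2 ∧ colf e.1 (σ (rp e.1)) = colf e.2 (σ (rp e.2)))
    (fun e σ => a ≤ ∑ u ∈ A e.1, h e.2 (colf u (σ (rp u))))
  let p : I → ℝ := Sum.elim (fun e => if F e.1 e.2 then 1 / 2 ^ s else 0)
    (fun _ => Real.exp (-(a ^ 2 / (16 * d))))
  obtain ⟨σ, hσ⟩ := local_lemma T B (by
      rintro (⟨u, v⟩ | ⟨v, k⟩)
      · exact ⟨rp u, by simp [T]⟩
      · exact (hAne v).image rp) (by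
      rintro (⟨u, v⟩ | ⟨v, k⟩) σ τ hst
      · simp only [T, Sum.elim_inl, Finset.mem_insert, Finset.mem_singleton, forall_eq_or_imp,
          forall_eq] at hst
        simp only [B, Sum.elim_inl, hst.1, hst.2, imp_self]
      · intro hb
        simp only [T, B, Sum.elim_inr] at hst hb ⊢
        refine hb.trans (le_of_eq ?_)
        apply Finset.sum_congr rfl
        intro u hu
        rw [hst _ (Finset.mem_image_of_mem _ hu)]) p η hη0 hη1 (by
      rintro (⟨u, v⟩ | ⟨v, k⟩)
      · simp only [B, p, Sum.elim_inl]
        by_cases hf : F u v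
        · have hne : rp u ≠ rp v := fun hc => by
            rcases rp_inj _ _ hc with h | h
            · exact (hF u v hf).1 h
            · exact (hF u v hf).2 h
          simp only [hf, true_and, if_true]
          rw [div_mul_eq_mul_div, one_mul, le_div_iff₀ (by positivity)]
          have hcard : (2 : ℝ) ^ s = ((Fintype.card (Fin s → Bool) : ℕ) : ℝ) := by simp
          rw [hcard]
          norm_cast
          rw [← Finset.card_univ, ← Finset.card_univ, ← Finset.card_product]
          apply Finset.card_le_card_of_injOn (fun z => Function.update z.1 (rp u) z.2)
          · intro z _; simp
          · rintro ⟨σ, c⟩ hz ⟨τ, c'⟩ hz' heq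
            simp only [Finset.coe_product, Set.mem_prod, Finset.mem_coe, Finset.mem_filter,
              Finset.mem_univ, true_and, and_true] at hz hz' heq
            have hc : c = c' := by
              have := congrFun heq (rp u)
              simpa using this
            have hoff : ∀ x, x ≠ rp u → σ x = τ x := by
              intro x hx
              have := congrFun heq x
              simpa [Function.update_of_ne hx] using this
            have hon : σ (rp u) = τ (rp u) := by
              apply (colf_bij u).1
              rw [hz, hz', hoff _ (Ne.symm hne)]
            refine Prod.ext (funext fun x => ?_) hc
            by_cases hx : x = rp u
            · rw [hx]; exact hon
            · exact hoff x hx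
        · simp [hf]
      · exact conc (A v) (h k) (hh k) (hh0 k) a d (by exact_mod_cast hd) (by exact_mod_cast hA v)
          ha had) (by
      intro x
      refine le_trans ?_ hη
      rw [Finset.sum_filter, Fintype.sum_sum_type]
      apply add_le_add
      · have hpt : ∀ e : Fin n × Fin n, (if x ∈ T (Sum.inl e) then p (Sum.inl e) / (1 - η) ^ (T (Sum.inl e)).card else 0)
            ≤ if (F e.1 e.2 ∧ (rp e.1 = x ∨ rp e.2 = x)) then 1 / 2 ^ s / (1 - η) ^ 2 else 0 := by
          rintro ⟨u, v⟩
          simp only [T, p, Sum.elim_inl, Finset.mem_insert, Finset.mem_singleton]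
          by_cases hf : F u v
          · by_cases hx : x = rp u ∨ x = rp v
            · have hx' : rp u = x ∨ rp v = x := by rcases hx with h | h <;> simp [h]
              simp only [hx, hx', hf, if_true, and_self]
              apply div_le_div_of_nonneg_left (by positivity) (by positivity)
              exact pow_le_pow_of_le_one h1.le h1' Finset.card_le_two
            · rw [if_neg hx]; split_ifs <;> positivity
          · simp [hf]
        refine (Finset.sum_le_sum fun e _ => hpt e).trans ?_
        rw [← Finset.sum_filter, Finset.sum_const, nsmul_eq_mul]
        have hcnt : ((Finset.univ.filter (fun e : Fin n × Fin n => F e.1 e.2 ∧ (rp e.1 = x ∨ rp e.2 = x))).card : ℝ) ≤ 4 * d1 := by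
          let N : Fin n → Finset (Fin n) := fun v => Finset.univ.filter (fun u => F v u)
          have hsub : Finset.univ.filter (fun e : Fin n × Fin n => F e.1 e.2 ∧ (rp e.1 = x ∨ rp e.2 = x))
              ⊆ ((N x).image (fun u => (x, u)) ∪ (N x.rev).image (fun u => (x.rev, u))) ∪
                ((N x).image (fun u => (u, x)) ∪ (N x.rev).image (fun u => (u, x.rev))) := by
            rintro ⟨u, v⟩ he
            simp only [Finset.mem_filter, Finset.mem_univ, true_and] at he
            simp only [Finset.mem_union, Finset.mem_image, Prod.mk.injEq, N, Finset.mem_filter,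
              Finset.mem_univ, true_and]
            obtain ⟨hf, hx | hx⟩ := he
            · left
              rcases eq_of_rp _ _ hx with h | h
              · left; exact ⟨v, h ▸ hf, h.symm, rfl⟩
              · right; exact ⟨v, h ▸ hf, h.symm, rfl⟩
            · right
              rcases eq_of_rp _ _ hx with h | h
              · left; exact ⟨u, h ▸ hFsymm _ _ hf, rfl, h.symm⟩
              · right; exact ⟨u, h ▸ hFsymm _ _ hf, rfl, h.symm⟩
          have hc := Finset.card_le_card hsub
          have hc2 : (Finset.univ.filter (fun e : Fin n × Fin n => F e.1 e.2 ∧ (rp e.1 = x ∨ rp e.2 = x))).card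
              ≤ ((N x).card + (N x.rev).card) + ((N x).card + (N x.rev).card) := by
            refine hc.trans ((Finset.card_union_le _ _).trans (add_le_add ?_ ?_)) <;>
            · refine (Finset.card_union_le _ _).trans (add_le_add ?_ ?_) <;> exact Finset.card_image_le
          have a1 := hFd x
          have a2 := hFd x.rev
          have hc3 : ((Finset.univ.filter (fun e : Fin n × Fin n => F e.1 e.2 ∧ (rp e.1 = x ∨ rp e.2 = x))).card : ℝ)
              ≤ (((N x).card : ℝ) + (N x.rev).card) + ((N x).card + (N x.rev).card) := by exact_mod_cast hc2
          simp only [N] at hc3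
          linarith
        calc _ ≤ 4 * d1 * (1 / 2 ^ s / (1 - η) ^ 2) := by
              apply mul_le_mul_of_nonneg_right hcnt; positivity
          _ = _ := by ring
      · set ex := Real.exp (-(a ^ 2 / (16 * d))) with hex
        have hex0 : 0 < ex := Real.exp_pos _
        have hpt : ∀ e : Fin n × K, (if x ∈ T (Sum.inr e) then p (Sum.inr e) / (1 - η) ^ (T (Sum.inr e)).card else 0)
            ≤ if (x ∈ A e.1 ∨ x.rev ∈ A e.1) then ex / (1 - η) ^ d else 0 := by
          rintro ⟨v, k⟩
          by_cases hx : x ∈ T (Sum.inr (v, k))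
          · have hx' : x ∈ A v ∨ x.rev ∈ A v := by
              obtain ⟨u, hu, hux⟩ := Finset.mem_image.mp hx
              rcases eq_of_rp _ _ hux with h | h
              · left; exact h ▸ hu
              · right; exact h ▸ hu
            rw [if_pos hx, if_pos hx']
            change ex / (1 - η) ^ ((A v).image rp).card ≤ _
            apply div_le_div_of_nonneg_left hex0.le (by positivity)
            exact pow_le_pow_of_le_one h1.le h1' (Finset.card_image_le.trans (hA v))
          · rw [if_neg hx]; split_ifs <;> positivity
        refine (Finset.sum_le_sum fun e _ => hpt e).trans ?_
        rw [← Finset.sum_filter, Finset.sum_const, nsmul_eq_mul]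
        have hcnt : (Finset.univ.filter (fun e : Fin n × K => x ∈ A e.1 ∨ x.rev ∈ A e.1)).card
            ≤ 2 * d * Fintype.card K := by
          have hsub : Finset.univ.filter (fun e : Fin n × K => x ∈ A e.1 ∨ x.rev ∈ A e.1)
              ⊆ (Finset.univ.filter (fun v => x ∈ A v) ∪ Finset.univ.filter (fun v => x.rev ∈ A v)) ×ˢ
                (Finset.univ : Finset K) := by
            rintro ⟨v, k⟩ he
            simpa using he
          refine (Finset.card_le_card hsub).trans ?_
          rw [Finset.card_product, Finset.card_univ]
          apply Nat.mul_le_mul_right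
          refine (Finset.card_union_le _ _).trans ?_
          have := hAu x
          have := hAu x.rev
          omega
        calc _ ≤ (2 * d * Fintype.card K : ℝ) * (ex / (1 - η) ^ d) := by
              apply mul_le_mul_of_nonneg_right _ (by positivity)
              exact_mod_cast hcnt
          _ = _ := by ring)
  refine ⟨fun v => colf v (σ (rp v)), ?_, ?_, ?_⟩
  · intro v
    simp only [rp_rev hn, colf_rev hn]
  · intro u v hf heq
    exact hσ (Sum.inl (u, v)) ⟨hf, heq⟩
  · intro v k
    by_contra hc
    exact hσ (Sum.inr (v, k)) (not_lt.mp hc)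

/-- number of (ordered) adjacent pairs between two sets. -/
noncomputable def eC {V : Type} (H : SimpleGraph V) (S T : Finset V) : ℕ :=
  ((S ×ˢ T).filter (fun e => H.Adj e.1 e.2)).card

lemma eml {n : ℕ} (d : ℕ) (hd : 0 < d) (hn : 0 < n) (G : SimpleGraph (Fin n))
    (hreg : ∀ v, (Finset.univ.filter (fun u => G.Adj v u)).card = d)
    (hA : (SimpleGraph.adjMatrix ℝ G).IsHermitian)
    (i₀ : Fin n) (h0 : hA.eigenvalues i₀ = d)
    (hl : ∀ i, i ≠ i₀ → |hA.eigenvalues i| ≤ (d : ℝ) / 12) (S U : Finset (Fin n)) :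
    (eC G S U : ℝ) ≤ d / n * S.card * U.card + d / 24 * (S.card + U.card) := by
  set lam := hA.eigenvalues with hlam
  let b := hA.eigenvectorBasis
  let M := SimpleGraph.adjMatrix ℝ G
  let α : Fin n → (Fin n → ℝ) → ℝ := fun i x => ∑ v, x v * b i v
  have pars : ∀ x y : Fin n → ℝ, ∑ i, α i x * α i y = ∑ v, x v * y v := by
    intro x y
    have := b.sum_inner_mul_inner (WithLp.toLp 2 x) (WithLp.toLp 2 y)
    simp only [PiLp.inner_apply, RCLike.inner_apply, conj_trivial] at this
    simp only [α]
    rw [← Finset.sum_congr rfl (fun v _ => mul_comm (y v) (x v)), ← this]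
    apply Finset.sum_congr rfl
    intro i _
    congr 1
    exact Finset.sum_congr rfl (fun v _ => mul_comm _ _)
  have eig : ∀ i v, ∑ u, M v u * b i u = lam i * b i v := by
    intro i v
    have := congrFun (hA.mulVec_eigenvectorBasis i) v
    simp only [Matrix.mulVec, dotProduct, Pi.smul_apply, smul_eq_mul] at this
    exact this
  have symmM : ∀ u v, M u v = M v u := by
    intro u v
    simp [M, SimpleGraph.adjMatrix_apply, G.adj_comm]
  have hαM : ∀ i (x : Fin n → ℝ), α i (fun v => ∑ u, M v u * x u) = lam i * α i x := by
    intro i x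
    simp only [α]
    simp_rw [Finset.sum_mul, Finset.mul_sum]
    rw [Finset.sum_comm]
    apply Finset.sum_congr rfl
    intro u _
    calc ∑ v, M v u * x u * b i v = x u * ∑ v, M u v * b i v := by
          rw [Finset.mul_sum]
          apply Finset.sum_congr rfl
          intro v _
          rw [symmM v u]; ring
      _ = lam i * (x u * b i u) := by rw [eig]; ring
  have hone : ∀ i, i ≠ i₀ → α i (fun _ => 1) = 0 := by
    intro i hi
    have h1 := hαM i (fun _ => 1)
    have h2 : (fun v => ∑ u, M v u * (1 : ℝ)) = fun v => (d : ℝ) * 1 := by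
      funext v
      rw [← hreg v]
      simp [M, SimpleGraph.adjMatrix_apply, Finset.sum_boole]
    rw [h2] at h1
    have h3 : α i (fun _ => (d : ℝ) * 1) = d * α i (fun _ => 1) := by
      simp only [α]; rw [Finset.mul_sum]; apply Finset.sum_congr rfl; intro v _; ring
    rw [h3] at h1
    have h4 := (abs_le.mp (hl i hi)).2
    have hd' : (0 : ℝ) < d := by exact_mod_cast hd
    have h5 : ((d : ℝ) - lam i) * α i (fun _ => 1) = 0 := by linarith
    rcases mul_eq_zero.mp h5 with h | h
    · linarith
    · exact h
  let ind : Finset (Fin n) → Fin n → ℝ := fun S v => if v ∈ S then 1 else 0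
  have hsum1 : ∀ x, α i₀ x * α i₀ (fun _ => 1) = ∑ v, x v := by
    intro x
    have := pars x (fun _ => 1)
    rw [Finset.sum_eq_single i₀ (by intro i _ hi; rw [hone i hi, mul_zero]) (by simp)] at this
    simpa using this
  have hcardS : ∀ S : Finset (Fin n), ∑ v, ind S v = S.card := by
    intro S; simp [ind]
  have hnn : α i₀ (fun _ => 1) * α i₀ (fun _ => 1) = n := by
    rw [hsum1]; simp
  have hn' : (0 : ℝ) < n := by exact_mod_cast hn
  have hmain : α i₀ (ind S) * α i₀ (ind U) = S.card * U.card / n := by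
    rw [eq_div_iff hn'.ne', ← hnn, ← hcardS S, ← hcardS U, ← hsum1, ← hsum1]; ring
  have hsq : ∀ S : Finset (Fin n), ∑ i, α i (ind S) ^ 2 = S.card := by
    intro S
    have := pars (ind S) (ind S)
    simp_rw [← pow_two] at this
    rw [this, ← hcardS]
    apply Finset.sum_congr rfl
    intro v _
    simp only [ind]; split_ifs <;> simp
  have he : (eC G S U : ℝ) = ∑ i, lam i * (α i (ind S) * α i (ind U)) := by
    have h1 := pars (ind S) (fun v => ∑ u, M v u * ind U u)
    simp_rw [hαM] at h1
    have h2 : ∑ i, lam i * (α i (ind S) * α i (ind U)) = ∑ i, α i (ind S) * (lam i * α i (ind U)) :=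
      Finset.sum_congr rfl (fun i _ => by ring)
    rw [h2, h1]
    unfold eC
    rw [Finset.card_filter, Finset.sum_product]
    push_cast
    rw [← Finset.sum_subset (Finset.subset_univ S) (by
      intro v _ hv; simp [ind, hv])]
    apply Finset.sum_congr rfl
    intro v hv
    simp only [ind, hv, if_true, one_mul]
    rw [← Finset.sum_subset (Finset.subset_univ U) (by
      intro u _ hu; simp [hu])]
    apply Finset.sum_congr rfl
    intro u hu
    simp [hu, M, SimpleGraph.adjMatrix_apply]
  rw [he, ← Finset.add_sum_erase _ _ (Finset.mem_univ i₀), h0, hmain]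
  have hrest : ∑ i ∈ Finset.univ.erase i₀, lam i * (α i (ind S) * α i (ind U))
      ≤ ∑ i, (d : ℝ) / 24 * (α i (ind S) ^ 2 + α i (ind U) ^ 2) := by
    refine le_trans (Finset.sum_le_sum (g := fun i => (d : ℝ) / 24 * (α i (ind S) ^ 2 + α i (ind U) ^ 2)) ?_) (Finset.sum_le_sum_of_subset_of_nonneg
      (Finset.erase_subset _ _) (fun i _ _ => by positivity))
    intro i hi
    have h4 := hl i (Finset.ne_of_mem_erase hi)
    have h5 : |α i (ind S) * α i (ind U)| ≤ (α i (ind S) ^ 2 + α i (ind U) ^ 2) / 2 := by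
      rw [abs_le]; constructor <;> nlinarith [sq_nonneg (α i (ind S) + α i (ind U)), sq_nonneg (α i (ind S) - α i (ind U))]
    calc lam i * (α i (ind S) * α i (ind U)) ≤ |lam i| * |α i (ind S) * α i (ind U)| := by
          rw [← abs_mul]; exact le_abs_self _
      _ ≤ (d : ℝ) / 12 * ((α i (ind S) ^ 2 + α i (ind U) ^ 2) / 2) := by
          apply mul_le_mul h4 h5 (abs_nonneg _); positivity
      _ = _ := by ring
  rw [← Finset.mul_sum, Finset.sum_add_distrib, hsq, hsq] at hrest
  have : (d : ℝ) * (S.card * U.card / n) = d / n * S.card * U.card := by ring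
  linarith

lemma eC_comm {V : Type} (H : SimpleGraph V) (S T : Finset V) : eC H S T = eC H T S := by
  unfold eC
  refine Finset.card_bij' (fun e _ => (e.2, e.1)) (fun e _ => (e.2, e.1)) ?_ ?_ ?_ ?_
  · rintro ⟨u, v⟩ h
    simp only [Finset.mem_filter, Finset.mem_product] at h ⊢
    exact ⟨⟨h.1.2, h.1.1⟩, h.2.symm⟩
  · rintro ⟨u, v⟩ h
    simp only [Finset.mem_filter, Finset.mem_product] at h ⊢
    exact ⟨⟨h.1.2, h.1.1⟩, h.2.symm⟩
  · rintro ⟨u, v⟩ _; rfl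
  · rintro ⟨u, v⟩ _; rfl

lemma eC_split {V : Type} [DecidableEq V] (H : SimpleGraph V) (S Q U : Finset V) (hU : U ⊆ Q) :
    eC H S Q = eC H S U + eC H S (Q \ U) := by
  unfold eC
  rw [← Finset.card_union_of_disjoint]
  · congr 1
    ext ⟨u, v⟩
    simp only [Finset.mem_filter, Finset.mem_product, Finset.mem_union, Finset.mem_sdiff]
    by_cases hv : v ∈ U
    · have := hU hv; simp [hv, this]
    · simp [hv]
  · rw [Finset.disjoint_left]
    rintro ⟨u, v⟩ h1 h2
    simp only [Finset.mem_filter, Finset.mem_product, Finset.mem_sdiff] at h1 h2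
    exact h2.1.2.2 h1.1.2

lemma eC_sum {V : Type} (H : SimpleGraph V) (S T : Finset V) :
    eC H S T = ∑ v ∈ S, (T.filter (fun u => H.Adj v u)).card := by
  unfold eC
  rw [Finset.card_filter, Finset.sum_product]
  apply Finset.sum_congr rfl
  intro v _
  rw [Finset.card_filter]

/-- Bipartite factor theorem (Ore–Ryser). -/
lemma factor {V : Type} [Fintype V] [DecidableEq V] (H : SimpleGraph V) (P Q : Finset V) (hPQ : Disjoint P Q)
    (f : V → ℕ) (hf : ∑ v ∈ P, f v = ∑ v ∈ Q, f v)
    (hH : ∀ S ⊆ P, ∀ U ⊆ Q, ∑ v ∈ U, f v ≤ ∑ v ∈ S, f v + eC H (P \ S) U) :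
    ∃ F : SimpleGraph V, F ≤ H ∧ (∀ u v, F.Adj u v → (u ∈ P ∧ v ∈ Q) ∨ (u ∈ Q ∧ v ∈ P)) ∧
      ∀ v, v ∈ P ∪ Q → (Finset.univ.filter (fun u => F.Adj v u)).card = f v := by
  let E := {e : V × V // e ∈ (P ×ˢ Q).filter (fun e => H.Adj e.1 e.2)}
  have hE : ∀ e : E, e.1.1 ∈ P ∧ e.1.2 ∈ Q ∧ H.Adj e.1.1 e.1.2 := by
    intro e
    have := e.2
    simp only [Finset.mem_filter, Finset.mem_product] at this
    exact ⟨this.1.1, this.1.2, this.2⟩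
  let dg : V → ℕ := fun q => (P.filter (fun p => H.Adj q p)).card
  have hdg : ∀ q ∈ Q, f q ≤ dg q := by
    intro q hq
    have := hH ∅ (by simp) {q} (by simpa using hq)
    rw [eC_comm, eC_sum] at this
    simpa [dg] using this
  have hPnQ : ∀ v, v ∈ P → v ∉ Q := fun v h1 h2 => Finset.disjoint_left.mp hPQ h1 h2
  let cap : V → ℕ := fun v => if v ∈ P then f v else if v ∈ Q then dg v - f v else 0
  have hcapP : ∀ S ⊆ P, ∑ v ∈ S, cap v = ∑ v ∈ S, f v := by
    intro S hS
    apply Finset.sum_congr rfl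
    intro v hv
    simp [cap, hS hv]
  have hcapQ : ∀ U ⊆ Q, ∑ v ∈ U, cap v + ∑ v ∈ U, f v = eC H P U := by
    intro U hU
    rw [eC_comm, eC_sum, ← Finset.sum_add_distrib]
    apply Finset.sum_congr rfl
    intro v hv
    have h1 : v ∉ P := fun h => hPnQ v h (hU hv)
    simp only [cap, h1, hU hv, if_true, if_false]
    exact Nat.sub_add_cancel (hdg v (hU hv))
  have hcardE : Fintype.card E = eC H P Q := by
    rw [Fintype.card_coe]; rfl
  obtain ⟨o, ho, hoc⟩ := orient (fun e : E => e.1.1) (fun e : E => e.1.2) cap (by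
    have h1 : ∑ v, cap v = ∑ v ∈ P ∪ Q, cap v := by
      symm
      apply Finset.sum_subset (Finset.subset_univ _)
      intro v _ hv
      simp only [Finset.mem_union, not_or] at hv
      simp [cap, hv.1, hv.2]
    rw [h1, Finset.sum_union hPQ, hcapP P (le_refl _), hf, hcardE, ← hcapQ Q (le_refl _)]
    ring) (by
    intro X
    set S := X.image (fun e : E => e.1.1) with hS
    set U := X.image (fun e : E => e.1.2) with hU
    have hSP : S ⊆ P := by
      intro v hv
      obtain ⟨e, _, rfl⟩ := Finset.mem_image.mp hv
      exact (hE e).1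
    have hUQ : U ⊆ Q := by
      intro v hv
      obtain ⟨e, _, rfl⟩ := Finset.mem_image.mp hv
      exact (hE e).2.1
    have hdis : Disjoint S U := Finset.disjoint_of_subset_left hSP (Finset.disjoint_of_subset_right hUQ hPQ)
    rw [Finset.sum_union hdis, hcapP S hSP]
    have h1 := hcapQ U hUQ
    have h2 := hH S hSP U hUQ
    have h3 : eC H P U = eC H S U + eC H (P \ S) U := by
      rw [eC_comm H P U, eC_comm H S U, eC_comm H (P \ S) U]
      exact eC_split H U P S hSP
    have h4 : X.card ≤ eC H S U := by
      unfold eC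
      apply Finset.card_le_card_of_injOn (fun e : E => e.1)
      · intro e he
        have he' : e ∈ X := he
        simp only [Finset.coe_filter, Finset.mem_product, Set.mem_ofPred_eq]
        exact ⟨⟨Finset.mem_image_of_mem _ he', Finset.mem_image_of_mem _ he'⟩, (hE e).2.2⟩
      · exact Subtype.val_injective.injOn
    omega)
  -- selected edges are those oriented to the P side
  let sel : V → V → Prop := fun p q => ∃ e : E, e.1 = (p, q) ∧ o e = p
  have hsel : ∀ p q, sel p q → p ∈ P ∧ q ∈ Q ∧ H.Adj p q := by
    rintro p q ⟨e, he, _⟩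
    have := hE e
    rw [he] at this
    exact this
  let F : SimpleGraph V :=
    { Adj := fun u v => sel u v ∨ sel v u
      symm := ⟨fun u v h => h.symm⟩
      loopless := ⟨fun u h => by
        rcases h with h | h <;> exact (hsel u u h).2.2.ne rfl⟩ }
  refine ⟨F, ?_, ?_, ?_⟩
  · intro u v h
    rcases h with h | h
    · exact (hsel _ _ h).2.2
    · exact (hsel _ _ h).2.2.symm
  · intro u v h
    rcases h with h | h
    · left; exact ⟨(hsel _ _ h).1, (hsel _ _ h).2.1⟩
    · right; exact ⟨(hsel _ _ h).2.1, (hsel _ _ h).1⟩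
  · intro v hv
    rcases Finset.mem_union.mp hv with hP | hQ
    · have hc := hoc v
      simp only [cap, hP, if_true] at hc
      rw [← hc]
      symm
      refine Finset.card_bij (fun e _ => e.1.2) ?_ ?_ ?_
      · intro e he
        simp only [Finset.mem_filter, Finset.mem_univ, true_and] at he ⊢
        left
        refine ⟨e, ?_, he⟩
        rcases ho e with h | h
        · rw [← he, h]
        · exfalso
          rw [he] at h
          exact hPnQ v hP (h ▸ (hE e).2.1)
      · intro e he e' he' heq
        simp only [Finset.mem_filter, Finset.mem_univ, true_and] at he he'
        have h1 : ∀ e : E, o e = v → e.1.1 = v := by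
          intro e he
          rcases ho e with h | h
          · rw [← h, he]
          · exfalso
            rw [he] at h
            exact hPnQ v hP (h ▸ (hE e).2.1)
        exact Subtype.ext (Prod.ext ((h1 e he).trans (h1 e' he').symm) heq)
      · intro q hq
        simp only [Finset.mem_filter, Finset.mem_univ, true_and] at hq
        rcases hq with h | h
        · obtain ⟨e, he, hoe⟩ := h
          exact ⟨e, by simpa using hoe, by rw [he]⟩
        · exact absurd (hsel _ _ h).2.1 (hPnQ v hP)
    · have hnP : v ∉ P := fun h => hPnQ v h hQ
      have hc := hoc v
      simp only [cap, hnP, hQ, if_true, if_false] at hc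
      have h1 : dg v = (Finset.univ.filter (fun u => F.Adj v u)).card + (Finset.univ.filter (fun e => o e = v)).card := by
        have h2 : dg v = (P.filter (fun p => H.Adj v p ∧ sel p v)).card + (P.filter (fun p => H.Adj v p ∧ ¬ sel p v)).card := by
          simp only [dg]
          rw [← Finset.card_filter_add_card_filter_not (s := P.filter (fun p => H.Adj v p)) (fun p => sel p v), Finset.filter_filter, Finset.filter_filter]
        rw [h2]
        congr 1
        · congr 1
          ext p
          simp only [Finset.mem_filter, Finset.mem_univ, true_and]
          constructor
          · rintro ⟨_, _, h⟩; exact Or.inr h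
          · rintro (h | h)
            · exact absurd (hsel _ _ h).1 hnP
            · exact ⟨(hsel _ _ h).1, (hsel _ _ h).2.2.symm, h⟩
        · symm
          refine Finset.card_bij (fun e _ => e.1.1) ?_ ?_ ?_
          · intro e he
            simp only [Finset.mem_filter, Finset.mem_univ, true_and] at he ⊢
            have h3 : e.1.2 = v := by
              rcases ho e with h | h
              · exfalso; rw [he] at h; exact hnP (h ▸ (hE e).1)
              · rw [← h, he]
            refine ⟨(hE e).1, h3 ▸ (hE e).2.2.symm, ?_⟩
            rintro ⟨e', he', hoe'⟩
            have : e' = e := Subtype.ext (by rw [he', ← h3])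
            rw [this, he] at hoe'
            exact hnP (hoe' ▸ (hE e).1)
          · intro e he e' he' heq
            simp only [Finset.mem_filter, Finset.mem_univ, true_and] at he he'
            have h3 : ∀ e : E, o e = v → e.1.2 = v := by
              intro e he
              rcases ho e with h | h
              · exfalso; rw [he] at h; exact hnP (h ▸ (hE e).1)
              · rw [← h, he]
            exact Subtype.ext (Prod.ext heq ((h3 e he).trans (h3 e' he').symm))
          · intro p hp
            simp only [Finset.mem_filter] at hp
            obtain ⟨hpP, hadj, hns⟩ := hp
            let e : E := ⟨(p, v), by simp [hpP, hQ, hadj.symm]⟩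
            refine ⟨e, ?_, rfl⟩
            simp only [Finset.mem_filter, Finset.mem_univ, true_and]
            rcases ho e with h | h
            · exact absurd ⟨e, rfl, h⟩ hns
            · exact h
      have := hdg v hQ
      rw [hc] at h1
      have h9 : (Finset.univ.filter (fun u => F.Adj v u)).card = f v := by omega
      rw [← h9]
      congr 1
      ext u
      simp

lemma exp_factor {n : ℕ} (d : ℕ) (hn : 0 < n) (G H : SimpleGraph (Fin n)) (hHG : H ≤ G)
    (heml : ∀ S U : Finset (Fin n),
      (eC G S U : ℝ) ≤ d / n * S.card * U.card + d / 24 * (S.card + U.card))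
    (P Q : Finset (Fin n)) (hPQ : Disjoint P Q) (hcard : P.card = Q.card)
    (f : Fin n → ℕ) (w : ℕ) (hf0 : ∀ v, 20 * w ≤ f v) (hf1 : ∀ v, f v ≤ 21 * w)
    (hf : ∑ v ∈ P, f v = ∑ v ∈ Q, f v) (D : ℝ)
    (hdP : ∀ v ∈ P, D ≤ (Q.filter (fun u => H.Adj v u)).card)
    (hdQ : ∀ v ∈ Q, D ≤ (P.filter (fun u => H.Adj v u)).card)
    (hD : 21 / 41 * (d * P.card / n) + 41 / 480 * d + 21 * w ≤ D) :
    ∃ F : SimpleGraph (Fin n), F ≤ H ∧ (∀ u v, F.Adj u v → (u ∈ P ∧ v ∈ Q) ∨ (u ∈ Q ∧ v ∈ P)) ∧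
      ∀ v, v ∈ P ∪ Q → (Finset.univ.filter (fun u => F.Adj v u)).card = f v := by
  have core : ∀ P Q : Finset (Fin n), P.card = Q.card →
      (∀ v ∈ P, D ≤ (Q.filter (fun u => H.Adj v u)).card) →
      (21 / 41 * (d * P.card / n) + 41 / 480 * d + 21 * w ≤ D) →
      ∀ S ⊆ P, ∀ U ⊆ Q, S.card + U.card ≤ P.card →
      ∑ v ∈ S, f v ≤ ∑ v ∈ U, f v + eC H S (Q \ U) := by
    intro P Q hcard hdP hD S hS U hU hSU
    have hSf : ∑ v ∈ S, f v ≤ S.card * (21 * w) := by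
      rw [← smul_eq_mul]; exact Finset.sum_le_card_nsmul _ _ _ (fun v _ => hf1 v)
    have hUf : U.card * (20 * w) ≤ ∑ v ∈ U, f v := by
      rw [← smul_eq_mul]; exact Finset.card_nsmul_le_sum _ _ _ (fun v _ => hf0 v)
    by_cases hc : 21 * S.card ≤ 20 * U.card
    · have : S.card * (21 * w) ≤ U.card * (20 * w) := by nlinarith
      omega
    · push Not at hc
      have hsp := eC_split H S Q U hU
      have hdeg : D * S.card ≤ eC H S Q := by
        rw [eC_sum]
        push_cast
        rw [mul_comm, ← nsmul_eq_mul]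
        exact Finset.card_nsmul_le_sum _ _ _ (fun v hv => hdP v (hS hv))
      have hle : eC H S U ≤ eC G S U := by
        unfold eC
        apply Finset.card_le_card
        intro e
        simp only [Finset.mem_filter]
        exact fun h => ⟨h.1, hHG h.2⟩
      have hle' : (eC H S U : ℝ) ≤ eC G S U := by exact_mod_cast hle
      have he := heml S U
      have hsp' : (eC H S Q : ℝ) = eC H S U + eC H S (Q \ U) := by exact_mod_cast hsp
      have hcR : (20 : ℝ) * U.card ≤ 21 * S.card := by exact_mod_cast hc.le
      have hSUR : (S.card : ℝ) + U.card ≤ P.card := by exact_mod_cast hSU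
      have hU2 : (U.card : ℝ) ≤ 21 / 41 * P.card := by linarith
      have hn' : (0 : ℝ) < n := by exact_mod_cast hn
      have hd0 : (0 : ℝ) ≤ d := by positivity
      have hs0 : (0 : ℝ) ≤ S.card := by positivity
      have h1 : (d : ℝ) / n * S.card * U.card ≤ 21 / 41 * (d * P.card / n) * S.card := by
        have : (d : ℝ) / n * S.card * U.card ≤ (d : ℝ) / n * S.card * (21 / 41 * P.card) :=
          mul_le_mul_of_nonneg_left hU2 (by positivity)
        refine this.trans (le_of_eq ?_)
        ring
      have h2 : (d : ℝ) / 24 * (S.card + U.card) ≤ 41 / 480 * d * S.card := by nlinarith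
      have h3 : (21 * w : ℝ) * S.card ≤ eC H S (Q \ U) := by
        have := mul_le_mul_of_nonneg_right hD hs0
        nlinarith
      have h4 : S.card * (21 * w) ≤ eC H S (Q \ U) := by
        have : ((S.card * (21 * w) : ℕ) : ℝ) ≤ eC H S (Q \ U) := by push_cast; linarith
        exact_mod_cast this
      omega
  apply factor H P Q hPQ f hf
  intro S hS U hU
  have cS : (P \ S).card + S.card = P.card := Finset.card_sdiff_add_card_eq_card hS
  have cU : (Q \ U).card + U.card = Q.card := Finset.card_sdiff_add_card_eq_card hU
  have sS : ∑ v ∈ P \ S, f v + ∑ v ∈ S, f v = ∑ v ∈ P, f v := Finset.sum_sdiff hS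
  have sU : ∑ v ∈ Q \ U, f v + ∑ v ∈ U, f v = ∑ v ∈ Q, f v := Finset.sum_sdiff hU
  by_cases hc : S.card + U.card ≤ P.card
  · have := core Q P hcard.symm hdQ (by rw [← hcard]; exact hD) U hU S hS (by omega)
    rw [eC_comm] at this
    exact this
  · have := core P Q hcard hdP hD (P \ S) Finset.sdiff_subset (Q \ U) Finset.sdiff_subset (by omega)
    rw [Finset.sdiff_sdiff_eq_self hU] at this
    omega

/-- degree, with classical decidability. -/
noncomputable def dgr {V : Type} [Fintype V] (H : SimpleGraph V) (v : V) : ℕ :=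
  (Finset.univ.filter (fun u => H.Adj v u)).card

lemma dgr_sup {V : Type} [Fintype V] (A B : SimpleGraph V)
    (h : ∀ u v, A.Adj u v → ¬ B.Adj u v) (v : V) : dgr (A ⊔ B) v = dgr A v + dgr B v := by
  unfold dgr
  rw [← Finset.card_union_of_disjoint]
  · congr 1
    ext u
    simp
  · rw [Finset.disjoint_left]
    intro u h1 h2
    simp only [Finset.mem_filter, Finset.mem_univ, true_and] at h1 h2
    exact h _ _ h1 h2

/-- remove a family of graphs -/
def rmv {V : Type} (G : SimpleGraph V) (I : Finset ℕ) (K : ℕ → SimpleGraph V) : SimpleGraph V where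
  Adj u v := G.Adj u v ∧ ∀ i ∈ I, ¬ (K i).Adj u v
  symm := ⟨fun _ _ h => ⟨h.1.symm, fun i hi h' => h.2 i hi h'.symm⟩⟩
  loopless := ⟨fun _ h => h.1.ne rfl⟩

lemma rmv_dgr {V : Type} [Fintype V] (G : SimpleGraph V) (I : Finset ℕ) (K : ℕ → SimpleGraph V)
    (hK : ∀ i ∈ I, K i ≤ G)
    (hd : ∀ i ∈ I, ∀ j ∈ I, i ≠ j → ∀ u v, (K i).Adj u v → ¬ (K j).Adj u v) (v : V) :
    dgr (rmv G I K) v + ∑ i ∈ I, dgr (K i) v = dgr G v := by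
  unfold dgr
  rw [← Finset.card_biUnion, ← Finset.card_union_of_disjoint]
  · congr 1
    ext u
    simp only [Finset.mem_union, Finset.mem_filter, Finset.mem_univ, true_and, Finset.mem_biUnion]
    constructor
    · rintro (h | ⟨i, hi, h⟩)
      · exact h.1
      · exact hK i hi h
    · intro h
      by_cases h' : ∃ a ∈ I, (K a).Adj v u
      · exact Or.inr h'
      · push Not at h'
        exact Or.inl ⟨h, h'⟩
  · rw [Finset.disjoint_left]
    intro u h1 h2
    simp only [Finset.mem_filter, Finset.mem_univ, true_and, Finset.mem_biUnion] at h1 h2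
    obtain ⟨i, hi, h⟩ := h2
    exact h1.2 i hi h
  · intro i hi j hj hij
    rw [Function.onFun, Finset.disjoint_left]
    intro u h1 h2
    simp only [Finset.mem_filter, Finset.mem_univ, true_and] at h1 h2
    exact hd i hi j hj hij _ _ h1 h2

lemma rmv_bound {V : Type} [Fintype V] (I : Finset ℕ) (K : ℕ → SimpleGraph V)
    (S : Finset V) (p q : V → Prop) (v : V) (c : ℕ) (hc : ∀ i ∈ I, dgr (K i) v ≤ c)
    (h : ∀ u ∈ S, p u → (∀ i ∈ I, ¬ (K i).Adj v u) → q u) :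
    (S.filter p).card ≤ (S.filter q).card + I.card * c := by
  have h1 : S.filter p ⊆ S.filter q ∪ I.biUnion (fun i => Finset.univ.filter (fun u => (K i).Adj v u)) := by
    intro u hu
    simp only [Finset.mem_union, Finset.mem_filter, Finset.mem_univ, true_and, Finset.mem_biUnion] at hu ⊢
    by_cases h' : ∃ a ∈ I, (K a).Adj v u
    · exact Or.inr h'
    · push Not at h'
      exact Or.inl ⟨hu.1, h u hu.1 hu.2 h'⟩
  refine (Finset.card_le_card h1).trans ((Finset.card_union_le _ _).trans ?_)
  apply Nat.add_le_add_left
  refine Finset.card_biUnion_le.trans ?_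
  rw [← smul_eq_mul]
  exact Finset.sum_le_card_nsmul _ _ _ (fun i hi => hc i hi)

lemma cross_sum {V : Type} [Fintype V] (L : SimpleGraph V) (P Q : Finset V)
    (hcr : ∀ u v, L.Adj u v → (u ∈ P → v ∈ Q)) : ∑ v ∈ P, dgr L v = eC L P Q := by
  rw [eC_sum]
  apply Finset.sum_congr rfl
  intro v hv
  unfold dgr
  congr 1
  ext u
  simp only [Finset.mem_filter, Finset.mem_univ, true_and]
  exact ⟨fun h => ⟨hcr v u h hv, h⟩, fun h => h.2⟩

lemma step {n : ℕ} (d : ℕ) (hn : 0 < n) (G H : SimpleGraph (Fin n)) (hHG : H ≤ G)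
    (heml : ∀ S U : Finset (Fin n),
      (eC G S U : ℝ) ≤ d / n * S.card * U.card + d / 24 * (S.card + U.card))
    (P Q : Finset (Fin n)) (hPQ : Disjoint P Q) (hcard : P.card = Q.card)
    (L : SimpleGraph (Fin n)) (l w : ℕ) (hL0 : ∀ v, l ≤ dgr L v) (hL1 : ∀ v, dgr L v ≤ l + w)
    (hsum : ∑ v ∈ P, dgr L v = ∑ v ∈ Q, dgr L v) (D : ℝ)
    (hdP : ∀ v ∈ P, D ≤ (Q.filter (fun u => H.Adj v u)).card)
    (hdQ : ∀ v ∈ Q, D ≤ (P.filter (fun u => H.Adj v u)).card)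
    (hD : 21 / 41 * (d * P.card / n) + 41 / 480 * d + 21 * w ≤ D) :
    ∃ F : SimpleGraph (Fin n), F ≤ H ∧ (∀ u v, F.Adj u v → (u ∈ P ∧ v ∈ Q) ∨ (u ∈ Q ∧ v ∈ P)) ∧
      ∀ v, v ∈ P ∪ Q → dgr F v + dgr L v = l + 21 * w := by
  have key : ∀ v, (l + 21 * w - dgr L v) + dgr L v = l + 21 * w := by
    intro v; have := hL1 v; omega
  obtain ⟨F, h1, h2, h3⟩ := exp_factor d hn G H hHG heml P Q hPQ hcard
    (fun v => l + 21 * w - dgr L v) w (by intro v; have := hL1 v; show 20 * w ≤ l + 21 * w - dgr L v; omega)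
    (by intro v; have := hL0 v; show l + 21 * w - dgr L v ≤ _; omega)
    (by
      have hP : ∑ v ∈ P, (l + 21 * w - dgr L v) + ∑ v ∈ P, dgr L v = P.card * (l + 21 * w) := by
        rw [← Finset.sum_add_distrib, Finset.sum_congr rfl (fun v _ => key v)]; simp
      have hQ : ∑ v ∈ Q, (l + 21 * w - dgr L v) + ∑ v ∈ Q, dgr L v = Q.card * (l + 21 * w) := by
        rw [← Finset.sum_add_distrib, Finset.sum_congr rfl (fun v _ => key v)]; simp
      rw [hcard] at hP
      omega) D hdP hdQ hD
  refine ⟨F, h1, h2, fun v hv => ?_⟩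
  have := h3 v hv
  unfold dgr at *
  rw [this, key]

/-- edges of `G` whose first differing bit is `j` -/
def Lj {V : Type} (G : SimpleGraph V) (b : ℕ → V → Bool) (j : ℕ) : SimpleGraph V where
  Adj u v := G.Adj u v ∧ b j u ≠ b j v ∧ ∀ i < j, b i u = b i v
  symm := ⟨fun _ _ h => ⟨h.1.symm, h.2.1.symm, fun i hi => (h.2.2 i hi).symm⟩⟩
  loopless := ⟨fun _ h => h.1.ne rfl⟩

/-- edges with different class (bits 0,1), differing at bit j -/
def Xj {V : Type} (G : SimpleGraph V) (b : ℕ → V → Bool) (j : ℕ) : SimpleGraph V where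
  Adj u v := G.Adj u v ∧ b j u ≠ b j v ∧ ¬ (b 0 u = b 0 v ∧ b 1 u = b 1 v)
  symm := ⟨fun _ _ h => ⟨h.1.symm, h.2.1.symm, fun h' => h.2.2 ⟨h'.1.symm, h'.2.symm⟩⟩⟩
  loopless := ⟨fun _ h => h.1.ne rfl⟩

lemma bal_card {n : ℕ} (p q : Fin n → Prop) [DecidablePred p] [DecidablePred q] (h : ∀ v, p v ↔ q v.rev) :
    (Finset.univ.filter p).card = (Finset.univ.filter q).card := by
  refine Finset.card_bij' (fun v _ => v.rev) (fun v _ => v.rev) ?_ ?_ ?_ ?_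
  · intro v hv; simp only [Finset.mem_filter, Finset.mem_univ, true_and] at hv ⊢; exact (h v).mp hv
  · intro v hv; simp only [Finset.mem_filter, Finset.mem_univ, true_and] at hv ⊢
    rw [h, Fin.rev_rev]; exact hv
  · intro v _; simp
  · intro v _; simp

lemma reservoirs {n : ℕ} (d : ℕ) (hn : 0 < n) (G : SimpleGraph (Fin n))
    (heml : ∀ S U : Finset (Fin n),
      (eC G S U : ℝ) ≤ d / n * S.card * U.card + d / 24 * (S.card + U.card))
    (b : ℕ → Fin n → Bool) (k : ℕ) (hb : ∀ j < k, ∀ v, b j v.rev = !b j v)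
    (w : ℕ) (l : ℕ → ℕ) (hl0 : ∀ j, 2 ≤ j → j < k → ∀ v, l j ≤ dgr (Lj G b j) v)
    (hl1 : ∀ j, 2 ≤ j → j < k → ∀ v, dgr (Lj G b j) v ≤ l j + w)
    (m3 : ℕ) (h3 : ∀ j, 2 ≤ j → j < k → ∀ v, m3 ≤ dgr (Xj G b j) v)
    (hnum : (0.342 : ℝ) * d + 21 * w + 21 * w * k ≤ m3) (m : ℕ) (hm : m ≤ k) :
    ∃ R : ℕ → SimpleGraph (Fin n), (∀ j, 2 ≤ j → j < m → R j ≤ Xj G b j) ∧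
      (∀ j, 2 ≤ j → j < m → ∀ v, dgr (R j) v + dgr (Lj G b j) v = l j + 21 * w) ∧
      (∀ i j, 2 ≤ i → i < j → j < m → ∀ u v, (R i).Adj u v → ¬ (R j).Adj u v) := by
  induction m with
  | zero => exact ⟨fun _ => ⊥, by intros; omega, by intros; omega, by intros; omega⟩
  | succ m ih =>
    obtain ⟨R, hR1, hR2, hR3⟩ := ih (by omega)
    by_cases hm2 : m < 2
    · exact ⟨R, by intros; omega, by intros; omega, by intros; omega⟩
    push Not at hm2
    have hmk : m < k := by omega
    set P := Finset.univ.filter (fun v => b m v = true) with hP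
    set Q := Finset.univ.filter (fun v => b m v = false) with hQ
    have hPQ : Disjoint P Q := by
      rw [Finset.disjoint_left]; intro v h1 h2
      simp only [hP, hQ, Finset.mem_filter, Finset.mem_univ, true_and] at h1 h2
      rw [h1] at h2; exact absurd h2 (by simp)
    have hun : ∀ v, v ∈ P ∪ Q := by
      intro v; simp only [hP, hQ, Finset.mem_union, Finset.mem_filter, Finset.mem_univ, true_and]
      cases b m v <;> simp
    have hcard : P.card = Q.card := by
      apply bal_card
      intro v; rw [hb m hmk]; cases b m v <;> simp
    have hcardn : P.card + Q.card = n := by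
      rw [← Finset.card_union_of_disjoint hPQ, Finset.eq_univ_iff_forall.mpr hun]; simp
    have hle : ∀ i ∈ Finset.Ico 2 m, ∀ v, dgr (R i) v ≤ 21 * w := by
      intro i hi v
      rw [Finset.mem_Ico] at hi
      have := hR2 i hi.1 hi.2 v
      have := hl0 i hi.1 (by omega) v
      omega
    have hdeg : ∀ v, ∀ S : Finset (Fin n), (∀ u, b m v ≠ b m u → u ∈ S) →
        ((m3 : ℝ) - 21 * w * k) ≤ (S.filter (fun u => (rmv (Xj G b m) (Finset.Ico 2 m) R).Adj v u)).card := by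
      intro v S hS
      have h1 := rmv_bound (Finset.Ico 2 m) R S (fun u => (Xj G b m).Adj v u)
        (fun u => (rmv (Xj G b m) (Finset.Ico 2 m) R).Adj v u) v (21 * w) (fun i hi => hle i hi v)
        (fun u _ h h' => ⟨h, h'⟩)
      have h2 : dgr (Xj G b m) v = (S.filter (fun u => (Xj G b m).Adj v u)).card := by
        unfold dgr; congr 1; ext u
        simp only [Finset.mem_filter, Finset.mem_univ, true_and]
        exact ⟨fun h => ⟨hS u h.2.1, h⟩, fun h => h.2⟩
      have h4 := h3 m hm2 hmk v
      have h5 : (Finset.Ico 2 m).card * (21 * w) ≤ k * (21 * w) := by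
        apply Nat.mul_le_mul_right; simp; omega
      have h6 : m3 ≤ (S.filter (fun u => (rmv (Xj G b m) (Finset.Ico 2 m) R).Adj v u)).card + k * (21 * w) := by
        omega
      have h7 : (m3 : ℝ) ≤ (S.filter (fun u => (rmv (Xj G b m) (Finset.Ico 2 m) R).Adj v u)).card + k * (21 * w) := by
        exact_mod_cast h6
      linarith
    obtain ⟨F, hF1, hF2, hF3⟩ := step d hn G (rmv (Xj G b m) (Finset.Ico 2 m) R)
      (fun u v h => h.1.1) heml P Q hPQ hcard (Lj G b m) (l m) w (hl0 m hm2 hmk) (hl1 m hm2 hmk)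
      (by
        rw [cross_sum (Lj G b m) P Q, cross_sum (Lj G b m) Q P, eC_comm]
        · intro u v h
          have := h.2.1
          simp only [hP, hQ, Finset.mem_filter, Finset.mem_univ, true_and]
          intro hu; rw [hu] at this; revert this; cases b m v <;> simp
        · intro u v h
          have := h.2.1
          simp only [hP, hQ, Finset.mem_filter, Finset.mem_univ, true_and]
          intro hu; rw [hu] at this; revert this; cases b m v <;> simp)
      ((m3 : ℝ) - 21 * w * k)
      (by
        intro v hv
        apply hdeg
        intro u hu
        simp only [hP, hQ, Finset.mem_filter, Finset.mem_univ, true_and] at hv ⊢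
        rw [hv] at hu; revert hu; cases b m u <;> simp)
      (by
        intro v hv
        apply hdeg
        intro u hu
        simp only [hP, hQ, Finset.mem_filter, Finset.mem_univ, true_and] at hv ⊢
        rw [hv] at hu; revert hu; cases b m u <;> simp)
      (by
        have hn' : (0 : ℝ) < n := by exact_mod_cast hn
        have h1 : (P.card : ℝ) = n / 2 := by
          have : (P.card : ℝ) + Q.card = n := by exact_mod_cast hcardn
          rw [← hcard] at this; linarith
        rw [h1]
        have h2 : (d : ℝ) * (n / 2) / n = d / 2 := by field_simp
        rw [h2]
        have : (0 : ℝ) ≤ d := by positivity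
        linarith)
    refine ⟨Function.update R m F, ?_, ?_, ?_⟩
    · intro j h2 hj
      by_cases h : j = m
      · subst h; rw [Function.update_self]; exact fun u v h => (hF1 h).1
      · rw [Function.update_of_ne h]; exact hR1 j h2 (by omega)
    · intro j h2 hj
      by_cases h : j = m
      · subst h; rw [Function.update_self]; exact fun v => hF3 v (hun v)
      · rw [Function.update_of_ne h]; exact hR2 j h2 (by omega)
    · intro i j h2 hij hj u v hu
      rw [Function.update_of_ne (by omega)] at hu
      by_cases h : j = m
      · subst h; rw [Function.update_self]
        intro h'
        exact (hF1 h').2 i (Finset.mem_Ico.mpr ⟨h2, hij⟩) hu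
      · rw [Function.update_of_ne h]
        exact hR3 i j h2 hij (by omega) u v hu

/-- vertices with given first two bits -/
noncomputable def cls {n : ℕ} (b : ℕ → Fin n → Bool) (α β : Bool) : Finset (Fin n) :=
  Finset.univ.filter (fun u => b 0 u = α ∧ b 1 u = β)

lemma mem_cls {n : ℕ} (b : ℕ → Fin n → Bool) (α β : Bool) (v : Fin n) :
    v ∈ cls b α β ↔ b 0 v = α ∧ b 1 v = β := by
  simp [cls]

/-- edges agreeing at bit 0 -/
def sameG {V : Type} (M : SimpleGraph V) (b : ℕ → V → Bool) : SimpleGraph V where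
  Adj u v := M.Adj u v ∧ b 0 u = b 0 v
  symm := ⟨fun _ _ h => ⟨h.1.symm, h.2.symm⟩⟩
  loopless := ⟨fun _ h => h.1.ne rfl⟩

/-- edges with both bits differing -/
def bothG {V : Type} (M : SimpleGraph V) (b : ℕ → V → Bool) : SimpleGraph V where
  Adj u v := M.Adj u v ∧ b 0 u ≠ b 0 v ∧ b 1 u ≠ b 1 v
  symm := ⟨fun _ _ h => ⟨h.1.symm, h.2.1.symm, h.2.2.symm⟩⟩
  loopless := ⟨fun _ h => h.1.ne rfl⟩

lemma cls_sum {n : ℕ} (M : SimpleGraph (Fin n)) (b : ℕ → Fin n → Bool) (S : Finset (Fin n)) :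
    ∑ v ∈ S, dgr M v = eC M S (cls b false false) + eC M S (cls b false true)
      + eC M S (cls b true false) + eC M S (cls b true true) := by
  simp only [eC_sum]
  rw [← Finset.sum_add_distrib, ← Finset.sum_add_distrib, ← Finset.sum_add_distrib]
  apply Finset.sum_congr rfl
  intro v _
  unfold dgr
  rw [Finset.card_eq_sum_card_fiberwise (f := fun u => (b 0 u, b 1 u)) (t := Finset.univ) (by intro u _; simp)]
  rw [Fintype.sum_prod_type]
  simp only [Fintype.sum_bool]
  have : ∀ α β, ((Finset.univ.filter (fun u => M.Adj v u)).filter (fun u => (b 0 u, b 1 u) = (α, β))).card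
      = ((cls b α β).filter (fun u => M.Adj v u)).card := by
    intro α β
    congr 1
    ext u
    simp only [Finset.mem_filter, Finset.mem_univ, true_and, mem_cls, Prod.mk.injEq]
    tauto
  rw [this, this, this, this]
  ring

lemma structural {n : ℕ} (d : ℕ) (hd : 0 < d) (hn : 0 < n) (G : SimpleGraph (Fin n))
    (hreg : ∀ v, dgr G v = d)
    (heml : ∀ S U : Finset (Fin n),
      (eC G S U : ℝ) ≤ d / n * S.card * U.card + d / 24 * (S.card + U.card))
    (b : ℕ → Fin n → Bool) (k : ℕ) (hk : 2 ≤ k) (hb : ∀ j < k, ∀ v, b j v.rev = !b j v)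
    (hpr : ∀ u v, G.Adj u v → ∃ j < k, b j u ≠ b j v)
    (w : ℕ) (l : ℕ → ℕ) (hl0 : ∀ j, 2 ≤ j → j < k → ∀ v, l j ≤ dgr (Lj G b j) v)
    (hl1 : ∀ j, 2 ≤ j → j < k → ∀ v, dgr (Lj G b j) v ≤ l j + w)
    (m3 : ℕ) (h3 : ∀ j, 2 ≤ j → j < k → ∀ v, m3 ≤ dgr (Xj G b j) v)
    (hnum : (0.342 : ℝ) * d + 21 * w + 21 * w * k ≤ m3)
    (q e : ℕ) (hq0 : ∀ v α β, q ≤ ((cls b α β).filter (fun u => G.Adj v u)).card)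
    (hq1 : ∀ v α β, ((cls b α β).filter (fun u => G.Adj v u)).card ≤ q + e)
    (hnum2 : (21 : ℝ) / 41 * (q + e) + 41 / 480 * d + 21 * (e + 21 * w * k) ≤ q - 21 * w * k) :
    ∃ Hs : ℕ → SimpleGraph (Fin n),
      (∀ i j, i < j → j < k → ∀ u v, (Hs i).Adj u v → ¬ (Hs j).Adj u v) ∧
      (∀ u v, G.Adj u v ↔ ∃ i < k, (Hs i).Adj u v) ∧
      (∀ i < k, ∃ r, ∀ v, dgr (Hs i) v = r) ∧
      (∀ i < k, ∀ u v, (Hs i).Adj u v → b i u ≠ b i v) := by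
  obtain ⟨R, hR1, hR2, hR3⟩ := reservoirs d hn G heml b k hb w l hl0 hl1 m3 h3 hnum k le_rfl
  set I := Finset.Ico 2 k with hI
  have hmI : ∀ i, i ∈ I ↔ 2 ≤ i ∧ i < k := fun i => Finset.mem_Ico
  let K : ℕ → SimpleGraph (Fin n) := fun j => Lj G b j ⊔ R j
  have hLR : ∀ i j, 2 ≤ i → i < k → 2 ≤ j → j < k → ∀ u v, (Lj G b i).Adj u v → ¬ (R j).Adj u v := by
    intro i j hi hik hj hjk u v h1 h2
    have := (hR1 j hj hjk h2).2.2
    exact this ⟨h1.2.2 0 (by omega), h1.2.2 1 (by omega)⟩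
  have hLL : ∀ i j, i < j → ∀ u v, (Lj G b i).Adj u v → ¬ (Lj G b j).Adj u v := by
    intro i j hij u v h1 h2
    exact h1.2.1 (h2.2.2 i hij)
  have hKK : ∀ i j, 2 ≤ i → i < j → j < k → ∀ u v, (K i).Adj u v → ¬ (K j).Adj u v := by
    intro i j hi hij hj u v h1 h2
    rcases h1 with h1 | h1 <;> rcases h2 with h2 | h2
    · exact hLL i j hij u v h1 h2
    · exact hLR i j hi (by omega) (by omega) hj u v h1 h2
    · exact hLR j i (by omega) hj hi (by omega) u v h2 h1
    · exact hR3 i j hi hij hj u v h1 h2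
  have hKG : ∀ i ∈ I, K i ≤ G := by
    intro i hi u v h
    rcases h with h | h
    · exact h.1
    · exact (hR1 i ((hmI i).mp hi).1 ((hmI i).mp hi).2 h).1
  have hKdeg : ∀ i ∈ I, ∀ v, dgr (K i) v = l i + 21 * w := by
    intro i hi v
    obtain ⟨hi1, hi2⟩ := (hmI i).mp hi
    have := dgr_sup (Lj G b i) (R i) (hLR i i hi1 hi2 hi1 hi2) v
    have h2 := hR2 i hi1 hi2 v
    show dgr (Lj G b i ⊔ R i) v = _
    omega
  set M := rmv G I K with hM
  have hMdeg : ∀ v, dgr M v + ∑ i ∈ I, (l i + 21 * w) = d := by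
    intro v
    have := rmv_dgr G I K hKG (by
      intro i hi j hj hij u v h1 h2
      obtain ⟨hi1, hi2⟩ := (hmI i).mp hi
      obtain ⟨hj1, hj2⟩ := (hmI j).mp hj
      rcases lt_or_gt_of_ne hij with h | h
      · exact hKK i j hi1 h hj2 u v h1 h2
      · exact hKK j i hj1 h hi2 u v h2 h1) v
    rw [hreg, Finset.sum_congr rfl (fun i hi => hKdeg i hi v)] at this
    exact this
  obtain ⟨r, hr⟩ : ∃ r, ∀ v, dgr M v = r :=
    ⟨d - ∑ i ∈ I, (l i + 21 * w), fun v => by have := hMdeg v; omega⟩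
  -- edges of M join different classes
  have hMc : ∀ u v, M.Adj u v → ¬ (b 0 u = b 0 v ∧ b 1 u = b 1 v) := by
    intro u v h hs
    have hex := hpr u v h.1
    let j := Nat.find hex
    have hj := Nat.find_spec hex
    have hjm : ∀ i < j, b i u = b i v := by
      intro i hi
      have := Nat.find_min hex hi
      by_contra hne
      exact this ⟨lt_trans hi hj.1, hne⟩
    have h2 : 2 ≤ j := by
      by_contra hlt
      push Not at hlt
      have : j = 0 ∨ j = 1 := by omega
      rcases this with h0 | h0
      · exact hj.2 (by show b j u = b j v; rw [h0]; exact hs.1)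
      · exact hj.2 (by show b j u = b j v; rw [h0]; exact hs.2)
    exact h.2 j ((hmI j).mpr ⟨h2, hj.1⟩) (Or.inl ⟨h.1, hj.2, hjm⟩)
  have hMG : M ≤ G := fun u v h => h.1
  have hcon : I.card * (21 * w) ≤ 21 * w * k := by
    have : I.card ≤ k := by simp [hI]
    nlinarith
  have hRle : ∀ i ∈ I, ∀ v, dgr (R i) v ≤ 21 * w := by
    intro i hi v
    obtain ⟨hi1, hi2⟩ := (hmI i).mp hi
    have := hR2 i hi1 hi2 v
    have := hl0 i hi1 hi2 v
    omega
  -- class degrees in M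
  have hMcl0 : ∀ v α β, (b 0 v ≠ α ∨ b 1 v ≠ β) →
      q ≤ ((cls b α β).filter (fun u => M.Adj v u)).card + 21 * w * k := by
    intro v α β hne
    have h1 := rmv_bound I R (cls b α β) (fun u => G.Adj v u) (fun u => M.Adj v u) v (21 * w)
      (fun i hi => hRle i hi v) (by
        intro u hu hadj hnR
        refine ⟨hadj, fun i hi h => ?_⟩
        rcases h with h | h
        · obtain ⟨hi1, hi2⟩ := (hmI i).mp hi
          rw [mem_cls] at hu
          have e0 := h.2.2 0 (by omega)
          have e1 := h.2.2 1 (by omega)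
          rcases hne with hne | hne
          · exact hne (e0.trans hu.1)
          · exact hne (e1.trans hu.2)
        · exact hnR i hi h)
    have := hq0 v α β
    omega
  have hMcl1 : ∀ v α β, ((cls b α β).filter (fun u => M.Adj v u)).card ≤ q + e := by
    intro v α β
    refine le_trans (Finset.card_le_card ?_) (hq1 v α β)
    intro u
    simp only [Finset.mem_filter]
    exact fun h => ⟨h.1, hMG h.2⟩
  set w' := e + 21 * w * k with hw'
  have hqbig : 21 * w * k ≤ q := by
    have : ((21 * w * k : ℕ) : ℝ) ≤ q := by
      push_cast
      have h1 : (0 : ℝ) ≤ (21 : ℝ) / 41 * (q + e) + 41 / 480 * d + 21 * (e + 21 * w * k) := by positivity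
      linarith
    exact_mod_cast this
  set L1 := sameG M b with hL1
  have hL1adj : ∀ u v, L1.Adj u v ↔ M.Adj u v ∧ b 0 u = b 0 v := fun u v => Iff.rfl
  have hL1deg : ∀ v, dgr L1 v = ((cls b (b 0 v) (!b 1 v)).filter (fun u => M.Adj v u)).card := by
    intro v
    unfold dgr
    congr 1
    ext u
    simp only [Finset.mem_filter, Finset.mem_univ, true_and, mem_cls, hL1adj]
    constructor
    · rintro ⟨h1, h2⟩
      refine ⟨⟨h2.symm, ?_⟩, h1⟩
      have := hMc v u h1
      by_contra hne
      apply this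
      refine ⟨h2, ?_⟩
      revert hne
      cases b 1 u <;> cases b 1 v <;> simp
    · rintro ⟨h1, h2⟩
      exact ⟨h2, h1.1.symm⟩
  have hL1lo : ∀ v, q - 21 * w * k ≤ dgr L1 v := by
    intro v
    rw [hL1deg]
    have := hMcl0 v (b 0 v) (!b 1 v) (Or.inr (by cases b 1 v <;> simp))
    omega
  have hL1hi : ∀ v, dgr L1 v ≤ (q - 21 * w * k) + w' := by
    intro v
    rw [hL1deg]
    have := hMcl1 v (b 0 v) (!b 1 v)
    omega
  have hcardcl : ∀ α β, (cls b α β).card = (cls b (!α) (!β)).card := by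
    intro α β
    apply bal_card
    intro v
    rw [hb 0 (by omega), hb 1 (by omega)]
    cases α <;> cases β <;> simp
  have hself : ∀ α β, eC M (cls b α β) (cls b α β) = 0 := by
    intro α β
    unfold eC
    rw [Finset.card_eq_zero, Finset.filter_eq_empty_iff]
    rintro ⟨u, v⟩ h hadj
    simp only [Finset.mem_product, mem_cls] at h
    exact hMc u v hadj ⟨h.1.1.trans h.2.1.symm, h.1.2.trans h.2.2.symm⟩
  have hL1sum : ∀ α β, ∑ v ∈ cls b α β, dgr L1 v = eC M (cls b α β) (cls b α (!β)) := by
    intro α β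
    rw [eC_sum]
    apply Finset.sum_congr rfl
    intro v hv
    rw [mem_cls] at hv
    rw [hL1deg, hv.1, hv.2]
  have hregcl : ∀ α β, ∑ v ∈ cls b α β, dgr M v = (cls b α β).card * r := by
    intro α β
    rw [Finset.sum_congr rfl (fun v _ => hr v)]; simp
  have hsums : eC M (cls b false false) (cls b false true) = eC M (cls b true true) (cls b true false) := by
    have s1 := hregcl false false
    have s2 := hregcl false true
    have s3 := hregcl true false
    have s4 := hregcl true true
    rw [cls_sum M b] at s1 s2 s3 s4
    rw [hself] at s1 s2 s3 s4
    have c1 := hcardcl false false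
    have c2 := hcardcl false true
    simp only [Bool.not_false, Bool.not_true] at c1 c2
    rw [c1] at s1
    rw [c2] at s2
    rw [eC_comm M (cls b false true) (cls b false false)] at s2
    rw [eC_comm M (cls b true false) (cls b false false), eC_comm M (cls b true false) (cls b false true)] at s3
    rw [eC_comm M (cls b true true) (cls b false false), eC_comm M (cls b true true) (cls b false true)] at s4
    rw [eC_comm M (cls b true true) (cls b true false)] at s4 ⊢
    omega
  have hclcard : ∀ α β, (d : ℝ) * (cls b α β).card / n ≤ q + e := by
    intro α β
    have h1 : d * (cls b α β).card ≤ n * (q + e) := by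
      have e1 : eC G (cls b α β) Finset.univ = (cls b α β).card * d := by
        rw [eC_sum]
        show ∑ v ∈ cls b α β, dgr G v = _
        rw [Finset.sum_congr rfl (fun v _ => hreg v)]
        simp
      have e2 : eC G Finset.univ (cls b α β) ≤ n * (q + e) := by
        rw [eC_sum]
        refine (Finset.sum_le_card_nsmul _ _ _ (fun v _ => hq1 v α β)).trans ?_
        simp
      rw [eC_comm, e1] at e2
      rw [mul_comm]; exact e2
    have hn' : (0 : ℝ) < n := by exact_mod_cast hn
    rw [div_le_iff₀ hn']
    have : (d : ℝ) * (cls b α β).card ≤ n * (q + e) := by exact_mod_cast h1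
    linarith
  set X := bothG M b with hX
  have hXdeg : ∀ α β, ∀ v ∈ cls b α β,
      ((q : ℝ) - 21 * w * k) ≤ ((cls b (!α) (!β)).filter (fun u => X.Adj v u)).card := by
    intro α β v hv
    rw [mem_cls] at hv
    have h1 := hMcl0 v (!α) (!β) (Or.inl (by rw [hv.1]; cases α <;> simp))
    have h2 : (cls b (!α) (!β)).filter (fun u => X.Adj v u) = (cls b (!α) (!β)).filter (fun u => M.Adj v u) := by
      apply Finset.filter_congr
      intro u hu
      rw [mem_cls] at hu
      constructor
      · exact fun h => h.1
      · intro h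
        refine ⟨h, ?_, ?_⟩
        · rw [hv.1, hu.1]; cases α <;> simp
        · rw [hv.2, hu.2]; cases β <;> simp
    rw [h2]
    have : (q : ℝ) ≤ ((cls b (!α) (!β)).filter (fun u => M.Adj v u)).card + 21 * w * k := by
      exact_mod_cast h1
    linarith
  have hfac : ∀ α β, (∑ v ∈ cls b α β, dgr L1 v = ∑ v ∈ cls b (!α) (!β), dgr L1 v) →
      ∃ F : SimpleGraph (Fin n), F ≤ X ∧
        (∀ u v, F.Adj u v → (u ∈ cls b α β ∧ v ∈ cls b (!α) (!β)) ∨ (u ∈ cls b (!α) (!β) ∧ v ∈ cls b α β)) ∧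
      ∀ v, v ∈ cls b α β ∪ cls b (!α) (!β) → dgr F v + dgr L1 v = (q - 21 * w * k) + 21 * w' := by
    intro α β hs
    apply step d hn G X (fun u v h => h.1.1) heml _ _ _ (hcardcl α β) L1 _ w' hL1lo hL1hi hs
      ((q : ℝ) - 21 * w * k) (hXdeg α β)
    · intro v hv
      have := hXdeg (!α) (!β) v hv
      simpa only [Bool.not_not] using this
    · have := hclcard α β
      rw [hw']
      push_cast
      linarith
    · rw [Finset.disjoint_left]
      intro v h1 h2
      rw [mem_cls] at h1 h2
      have := h1.1.symm.trans h2.1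
      revert this; cases α <;> simp
  obtain ⟨F1, hF1a, hF1b, hF1c⟩ := hfac false false (by
    rw [hL1sum, hL1sum]; exact hsums)
  obtain ⟨F2, hF2a, hF2b, hF2c⟩ := hfac false true (by
    rw [hL1sum, hL1sum]
    simp only [Bool.not_false, Bool.not_true]
    rw [eC_comm, hsums, eC_comm])
  simp only [Bool.not_false, Bool.not_true] at hF1b hF1c hF2b hF2c
  have hF12 : ∀ u v, F1.Adj u v → ¬ F2.Adj u v := by
    intro u v h1 h2
    have a1 := hF1b u v h1
    have a2 := hF2b u v h2
    simp only [mem_cls] at a1 a2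
    rcases a1 with a1 | a1 <;> rcases a2 with a2 | a2 <;>
      (have y := a2.1; rw [a1.1.1, a1.1.2] at y; simp at y)
  have hF0 : ∀ (F : SimpleGraph (Fin n)) (P Q : Finset (Fin n)),
      (∀ u v, F.Adj u v → (u ∈ P ∧ v ∈ Q) ∨ (u ∈ Q ∧ v ∈ P)) → ∀ v, v ∉ P → v ∉ Q → dgr F v = 0 := by
    intro F P Q h v hP hQ
    unfold dgr
    rw [Finset.card_eq_zero, Finset.filter_eq_empty_iff]
    intro u _ hadj
    rcases h v u hadj with h | h
    · exact hP h.1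
    · exact hQ h.1
  let F := F1 ⊔ F2
  have hFX : F ≤ X := sup_le hF1a hF2a
  have hFdeg : ∀ v, dgr F v + dgr L1 v = (q - 21 * w * k) + 21 * w' := by
    intro v
    have h1 : dgr F v = dgr F1 v + dgr F2 v := dgr_sup F1 F2 hF12 v
    rw [h1]
    by_cases hv : b 0 v = b 1 v
    · have h2 := hF0 F2 _ _ hF2b v (by rw [mem_cls, hv]; cases b 1 v <;> simp) (by rw [mem_cls, hv]; cases b 1 v <;> simp)
      rw [h2]
      apply hF1c
      rw [Finset.mem_union, mem_cls, mem_cls, hv]; cases b 1 v <;> simp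
    · have h2 := hF0 F1 _ _ hF1b v (by rw [mem_cls]; revert hv; cases b 1 v <;> cases b 0 v <;> simp)
        (by rw [mem_cls]; revert hv; cases b 1 v <;> cases b 0 v <;> simp)
      rw [h2, zero_add]
      apply hF2c
      rw [Finset.mem_union, mem_cls, mem_cls]; revert hv; cases b 1 v <;> cases b 0 v <;> simp
  let H1 := L1 ⊔ F
  have hH1deg : ∀ v, dgr H1 v = (q - 21 * w * k) + 21 * w' := by
    intro v
    have : dgr H1 v = dgr L1 v + dgr F v := dgr_sup L1 F (by
      intro u v h1 h2
      exact (hFX h2).2.1 h1.2) v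
    have := hFdeg v
    omega
  have hH1M : H1 ≤ M := by
    intro u v h
    rcases h with h | h
    · exact h.1
    · exact (hFX h).1
  let H0 := rmv M {1} (fun _ => H1)
  have hH0adj : ∀ u v, H0.Adj u v ↔ M.Adj u v ∧ ¬ H1.Adj u v := by
    intro u v
    show (M.Adj u v ∧ ∀ i ∈ ({1} : Finset ℕ), ¬ H1.Adj u v) ↔ _
    simp
  let Hs : ℕ → SimpleGraph (Fin n) := fun i => if i = 0 then H0 else if i = 1 then H1 else K i
  have e0 : Hs 0 = H0 := rfl
  have e1 : Hs 1 = H1 := rfl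
  have e2 : ∀ i, 2 ≤ i → Hs i = K i := by
    intro i hi
    show (if i = 0 then H0 else if i = 1 then H1 else K i) = K i
    rw [if_neg (by omega), if_neg (by omega)]
  have c3 : ∀ i, i = 0 ∨ i = 1 ∨ 2 ≤ i := by intro i; omega
  refine ⟨Hs, ?_, ?_, ?_, ?_⟩
  · intro i j hij hj u v h1 h2
    rcases c3 i with rfl | rfl | hi
    · rw [e0, hH0adj] at h1
      rcases c3 j with rfl | rfl | hj2
      · omega
      · exact h1.2 h2
      · rw [e2 j hj2] at h2
        exact h1.1.2 j ((hmI j).mpr ⟨hj2, hj⟩) h2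
    · rw [e2 j (by omega)] at h2
      exact (hH1M h1).2 j ((hmI j).mpr ⟨by omega, hj⟩) h2
    · rw [e2 i hi] at h1
      rw [e2 j (by omega)] at h2
      exact hKK i j hi hij hj u v h1 h2
  · intro u v
    constructor
    · intro h
      by_cases hKe : ∃ i ∈ I, (K i).Adj u v
      · obtain ⟨i, hi, hadj⟩ := hKe
        obtain ⟨hi1, hi2⟩ := (hmI i).mp hi
        exact ⟨i, hi2, by rw [e2 i hi1]; exact hadj⟩
      · push Not at hKe
        have hMa : M.Adj u v := ⟨h, hKe⟩
        by_cases h1 : H1.Adj u v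
        · exact ⟨1, by omega, h1⟩
        · exact ⟨0, by omega, (hH0adj u v).mpr ⟨hMa, h1⟩⟩
    · rintro ⟨i, hi, h⟩
      rcases c3 i with rfl | rfl | hi2
      · exact h.1.1
      · exact hMG (hH1M h)
      · rw [e2 i hi2] at h
        exact hKG i ((hmI i).mpr ⟨hi2, hi⟩) h
  · intro i hi
    rcases c3 i with rfl | rfl | hi2
    · refine ⟨r - ((q - 21 * w * k) + 21 * w'), fun v => ?_⟩
      have := rmv_dgr M {1} (fun _ => H1) (fun _ _ => hH1M) (by
        intro i hi j hj hij
        rw [Finset.mem_singleton] at hi hj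
        omega) v
      rw [Finset.sum_singleton, hr, hH1deg] at this
      show dgr H0 v = _
      have h' : dgr H0 v = dgr (rmv M {1} (fun _ => H1)) v := rfl
      omega
    · exact ⟨_, hH1deg⟩
    · exact ⟨_, fun v => by rw [e2 i hi2]; exact hKdeg i ((hmI i).mpr ⟨hi2, hi⟩) v⟩
  · intro i hi u v h
    rcases c3 i with rfl | rfl | hi2
    · rw [e0, hH0adj] at h
      intro hbb
      exact h.2 (Or.inl ⟨h.1, hbb⟩)
    · rcases h with h | h
      · intro hbb
        exact hMc u v h.1 ⟨h.2, hbb⟩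
      · exact (hFX h).2.2
    · rw [e2 i hi2] at h
      rcases h with h | h
      · exact h.2.1
      · exact (hR1 i hi2 hi h).2.1

/-- counting with classical decidability -/
noncomputable def cnt {α : Type} [Fintype α] (p : α → Prop) : ℕ := (Finset.univ.filter p).card

lemma cnt_eq {α : Type} [Fintype α] (p : α → Prop) [DecidablePred p] :
    cnt p = (Finset.univ.filter p).card := by
  unfold cnt
  congr

lemma cnt_congr {α : Type} [Fintype α] (p q : α → Prop) (h : ∀ x, p x ↔ q x) : cnt p = cnt q := by
  rw [show p = q from funext fun x => propext (h x)]

lemma cnt_add {α : Type} [Fintype α] (p q : α → Prop) :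
    cnt (fun x => p x ∧ q x) + cnt (fun x => p x ∧ ¬ q x) = cnt p := by
  rw [cnt_eq, cnt_eq, cnt_eq]
  have h2 := Finset.card_filter_add_card_filter_not (s := Finset.univ.filter p) q
  rw [Finset.filter_filter, Finset.filter_filter] at h2
  exact h2

lemma cnt_mono {α : Type} [Fintype α] (p q : α → Prop) (h : ∀ x, p x → q x) : cnt p ≤ cnt q := by
  unfold cnt
  apply Finset.card_le_card
  intro x
  simp only [Finset.mem_filter, Finset.mem_univ, true_and]
  exact h x

lemma stage1 {n : ℕ} (hn : Even n) (d t : ℕ) (hd : 2 ≤ d) (G : SimpleGraph (Fin n))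
    (hreg : ∀ v, dgr G v = d) (hT : ((2 : ℝ) ^ t) ^ 16 ≤ d)
    (hbig : 16 * (d : ℝ) ^ 3 ≤ Real.exp (Real.sqrt d / 16)) :
    ∃ x : Fin n → Fin t → Bool, (∀ v, x v.rev = cmpl (x v)) ∧
      ∀ v (p : (Fin t → Bool) → Prop),
        |(cnt (fun u => G.Adj v u ∧ p (x u)) : ℝ) - d * cnt p / 2 ^ t| ≤ d / (2 ^ t) ^ 2 := by
  set T : ℝ := (2 : ℝ) ^ t with hTdef
  have hT1 : 1 ≤ T := one_le_pow₀ (by norm_num)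
  have hT0 : 0 < T := by linarith
  have hd2 : (2 : ℝ) ≤ d := by exact_mod_cast hd
  have hd0 : (0 : ℝ) < d := by linarith
  have hTd : T ≤ d := by
    refine le_trans ?_ hT
    exact le_self_pow₀ hT1 (by norm_num)
  let a : ℝ := d / T ^ 3
  have ha0 : 0 ≤ a := by positivity
  have hexp : Real.sqrt d / 16 ≤ a ^ 2 / (16 * d) := by
    have h1 : a ^ 2 / (16 * d) = d / (T ^ 6) / 16 := by
      simp only [a]; field_simp
    rw [h1]
    apply div_le_div_of_nonneg_right _ (by norm_num)
    rw [le_div_iff₀ (by positivity)]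
    have h2 : T ^ 6 ≤ Real.sqrt d := by
      apply Real.le_sqrt_of_sq_le
      calc (T ^ 6) ^ 2 = T ^ 12 := by ring
        _ ≤ T ^ 16 := pow_le_pow_right₀ hT1 (by norm_num)
        _ ≤ d := hT
    calc Real.sqrt d * T ^ 6 ≤ Real.sqrt d * Real.sqrt d :=
          mul_le_mul_of_nonneg_left h2 (Real.sqrt_nonneg _)
      _ = d := Real.mul_self_sqrt hd0.le
  let h : ((Fin t → Bool) × Bool) → (Fin t → Bool) → ℝ := fun k c =>
    (if k.2 then 1 else -1) * ((if c = k.1 then 1 else 0) - 1 / T)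
  have hTinv : 0 ≤ 1 / T ∧ 1 / T ≤ 1 := ⟨by positivity, by rw [div_le_one hT0]; exact hT1⟩
  have hcardT : (Fintype.card (Fin t → Bool) : ℝ) = T := by simp [hTdef]
  obtain ⟨x, hx1, _, hx3⟩ := color_ex (s := t) hn (fun _ _ => False) 0 (by simp) (by simp) (by simp)
    d (by omega) (fun v => Finset.univ.filter (fun u => G.Adj v u)) (fun v => (hreg v).le)
    (by
      intro v
      rw [← Finset.card_pos]
      have := hreg v
      unfold dgr at this
      omega)
    (by
      intro u
      have := hreg u
      unfold dgr at this
      refine le_of_eq ?_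
      rw [← this]
      congr 1
      ext v
      simp [G.adj_comm])
    h (by
      rintro ⟨w, sg⟩ c
      simp only [h]
      rw [abs_mul]
      have e1 : |(if sg = true then (1 : ℝ) else -1)| = 1 := by split_ifs <;> simp
      rw [e1, one_mul, abs_le]
      split_ifs <;> constructor <;> linarith [hTinv.1, hTinv.2])
    (by
      rintro ⟨w, sg⟩
      simp only [h]
      rw [← Finset.mul_sum, Finset.sum_sub_distrib, Finset.sum_const, Finset.card_univ, nsmul_eq_mul, hcardT]
      rw [Finset.sum_ite_eq' Finset.univ w]
      simp [hT0.ne'])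
    a ha0 (by
      have : a ≤ d := div_le_self hd0.le (one_le_pow₀ hT1)
      linarith)
    (1 / d) (by positivity) (by rw [div_lt_one hd0]; linarith)
    (by
      have hK : (Fintype.card ((Fin t → Bool) × Bool) : ℝ) ≤ 2 * d := by
        rw [Fintype.card_prod]; push_cast; rw [hcardT]; simp; linarith
      have hE : Real.exp (-(a ^ 2 / (16 * d))) ≤ 1 / (16 * d ^ 3) := by
        rw [Real.exp_neg, ← one_div]
        apply one_div_le_one_div_of_le (by positivity)
        exact hbig.trans (Real.exp_le_exp.mpr hexp)
      have hP : (1 : ℝ) / 4 ≤ (1 - 1 / d) ^ d := by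
        -- split the exponent in halves
        obtain ⟨m, hm⟩ : ∃ m, d = 2 * m ∨ d = 2 * m + 1 := ⟨d / 2, by omega⟩
        have hb : ∀ m : ℕ, 1 - (m : ℝ) / d ≤ (1 - 1 / d) ^ m := by
          intro m
          have := one_add_mul_le_pow (a := -(1 / (d : ℝ))) (by
            have : 1 / (d : ℝ) ≤ 1 := by rw [div_le_one hd0]; linarith
            linarith) m
          calc 1 - (m : ℝ) / d = 1 + m * -(1 / (d : ℝ)) := by ring
            _ ≤ _ := this
            _ = _ := by ring
        rcases hm with hm | hm
        · have h1 := hb m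
          have h2 : (m : ℝ) / d = 1 / 2 := by
            have : (d : ℝ) = 2 * m := by exact_mod_cast hm
            rw [this]; field_simp
            rw [this] at hd0
            have : (m : ℝ) ≠ 0 := by intro h0; rw [h0] at hd0; simp at hd0
            field_simp
          have h3 : (1 - 1 / (d : ℝ)) ^ d = ((1 - 1 / (d : ℝ)) ^ m) ^ 2 := by
            rw [← pow_mul]; congr 1; omega
          rw [h3]; rw [h2] at h1; nlinarith
        · have h1 := hb m
          have h1' := hb (m + 1)
          have hdm : (d : ℝ) = 2 * m + 1 := by exact_mod_cast hm
          have hm1 : (1 : ℝ) ≤ m := by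
            have : 1 ≤ m := by omega
            exact_mod_cast this
          have h3 : (1 - 1 / (d : ℝ)) ^ d = (1 - 1 / (d : ℝ)) ^ m * (1 - 1 / (d : ℝ)) ^ m * (1 - 1 / d) := by
            rw [← pow_add, ← pow_succ]; congr 1; omega
          rw [h3]
          have h4 : (1 - (m : ℝ) / d) * (1 - (m : ℝ) / d) * (1 - 1 / d) ≤ (1 - 1 / (d : ℝ)) ^ m * (1 - 1 / (d : ℝ)) ^ m * (1 - 1 / d) := by
            have h5 : 0 ≤ 1 - (m : ℝ) / d := by
              rw [sub_nonneg, div_le_one hd0]; linarith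
            have h6 : 0 ≤ 1 - 1 / (d : ℝ) := by
              rw [sub_nonneg, div_le_one hd0]; linarith
            exact mul_le_mul_of_nonneg_right (mul_le_mul h1 h1 h5 (h5.trans h1)) h6
          refine le_trans ?_ h4
          have h5 : (1 - (m : ℝ) / d) * (1 - (m : ℝ) / d) * (1 - 1 / d) = ((m + 1) ^ 2 * (2 * m)) / (2 * m + 1) ^ 3 := by
            rw [hdm]; field_simp; ring
          rw [h5, div_le_div_iff₀ (by norm_num) (by positivity)]
          nlinarith [mul_nonneg (sub_nonneg.mpr hm1) (sub_nonneg.mpr hm1)]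
      simp only [mul_zero, zero_div, zero_add]
      calc 2 * (d : ℝ) * Fintype.card ((Fin t → Bool) × Bool) * Real.exp (-(a ^ 2 / (16 * d))) / (1 - 1 / d) ^ d
          ≤ 2 * (d : ℝ) * (2 * d) * (1 / (16 * d ^ 3)) / (1 / 4) := by
            gcongr
        _ = 1 / d := by field_simp; norm_num)
  refine ⟨x, hx1, ?_⟩
  intro v p
  rw [cnt_eq, cnt_eq]
  have hone : ∀ c, |((Finset.univ.filter (fun u => G.Adj v u ∧ x u = c)).card : ℝ) - d / T| ≤ a := by
    intro c
    have e1 : ∑ u ∈ Finset.univ.filter (fun u => G.Adj v u), ((if x u = c then (1 : ℝ) else 0) - 1 / T)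
        = ((Finset.univ.filter (fun u => G.Adj v u ∧ x u = c)).card : ℝ) - d / T := by
      rw [Finset.sum_sub_distrib, Finset.sum_const, nsmul_eq_mul]
      have := hreg v
      unfold dgr at this
      rw [this, Finset.sum_boole, Finset.filter_filter]
      ring
    have h1 := hx3 v (c, true)
    have h2 := hx3 v (c, false)
    simp only [h, if_true, one_mul, ← Finset.mul_sum] at h1 h2
    rw [e1] at h1 h2
    simp only [Bool.false_eq_true, if_false] at h2
    rw [abs_le]; constructor <;> linarith
  have hsum : ((Finset.univ.filter (fun u => G.Adj v u ∧ p (x u))).card : ℝ)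
      = ∑ c ∈ Finset.univ.filter p, ((Finset.univ.filter (fun u => G.Adj v u ∧ x u = c)).card : ℝ) := by
    rw [Finset.card_eq_sum_card_fiberwise (f := x) (t := Finset.univ.filter p) (by
      intro u hu
      simp at hu ⊢
      exact hu.2)]
    push_cast
    apply Finset.sum_congr rfl
    intro c hc
    simp only [Finset.mem_filter, Finset.mem_univ, true_and] at hc
    congr 2
    ext u
    simp only [Finset.mem_filter, Finset.mem_univ, true_and]
    constructor
    · rintro ⟨⟨h1, _⟩, h3⟩; exact ⟨h1, h3⟩
    · rintro ⟨h1, h3⟩; exact ⟨⟨h1, h3 ▸ hc⟩, h3⟩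
  have e2 : (d : ℝ) * (Finset.univ.filter p).card / T = ∑ c ∈ Finset.univ.filter p, (d : ℝ) / T := by
    rw [Finset.sum_const, nsmul_eq_mul]; ring
  rw [hsum, e2, ← Finset.sum_sub_distrib]
  refine (Finset.abs_sum_le_sum_abs _ _).trans ?_
  refine (Finset.sum_le_sum (fun c _ => hone c)).trans ?_
  rw [Finset.sum_const, nsmul_eq_mul]
  have hle : ((Finset.univ.filter p).card : ℝ) ≤ T := by
    rw [← hcardT]
    exact_mod_cast Finset.card_le_univ _
  calc ((Finset.univ.filter p).card : ℝ) * a ≤ T * a := mul_le_mul_of_nonneg_right hle ha0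
    _ = d / T ^ 2 := by simp only [a]; field_simp

lemma half_count {t : ℕ} (p : (Fin t → Bool) → Prop) (i : Fin t) (e : Bool)
    (hp : ∀ c : Fin t → Bool, p (Function.update c i (!c i)) ↔ p c) :
    2 * cnt (fun c => p c ∧ c i = e) = cnt p := by
  have h1 : cnt (fun c => p c ∧ c i = e) = cnt (fun c => p c ∧ ¬ c i = e) := by
    unfold cnt
    refine Finset.card_bij' (fun c _ => Function.update c i (!c i)) (fun c _ => Function.update c i (!c i)) ?_ ?_ ?_ ?_
    · intro c hc
      simp only [Finset.mem_filter, Finset.mem_univ, true_and] at hc ⊢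
      rw [hp]
      refine ⟨hc.1, ?_⟩
      rw [Function.update_self, hc.2]; simp
    · intro c hc
      simp only [Finset.mem_filter, Finset.mem_univ, true_and] at hc ⊢
      rw [hp]
      refine ⟨hc.1, ?_⟩
      have := hc.2
      rw [Function.update_self]; revert this; cases c i <;> cases e <;> simp
    · intro c _; simp
    · intro c _; simp
  have h2 := cnt_add p (fun c => c i = e)
  omega

lemma cnt_true {t : ℕ} : cnt (fun _ : Fin t → Bool => True) = 2 ^ t := by
  simp [cnt]

lemma count_pfx {t : ℕ} (c0 : Fin t → Bool) (j : ℕ) (hj : j ≤ t) :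
    2 ^ j * cnt (fun c : Fin t → Bool => ∀ i : Fin t, (i : ℕ) < j → c i = c0 i) = 2 ^ t := by
  induction j with
  | zero =>
    rw [cnt_congr _ (fun _ => True) (by intro x; simp), cnt_true]; simp
  | succ j ih =>
    have h1 := half_count (fun c : Fin t → Bool => ∀ i : Fin t, (i : ℕ) < j → c i = c0 i) ⟨j, hj⟩ (c0 ⟨j, hj⟩) (by
      intro c
      apply forall_congr'
      intro i
      apply imp_congr_right
      intro hi
      rw [Function.update_of_ne (by intro h; rw [h] at hi; simp at hi)])
    rw [cnt_congr _ (fun c : Fin t → Bool => (∀ i : Fin t, (i : ℕ) < j → c i = c0 i) ∧ c ⟨j, hj⟩ = c0 ⟨j, hj⟩) (by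
      intro c
      constructor
      · intro h; exact ⟨fun i hi => h i (by omega), h ⟨j, hj⟩ (by simp)⟩
      · rintro ⟨ha, hb⟩ i hi
        rcases Nat.lt_succ_iff_lt_or_eq.mp hi with h | h
        · exact ha i h
        · have : i = ⟨j, hj⟩ := Fin.ext h
          rw [this]; exact hb)]
    rw [pow_succ, mul_assoc, h1]
    exact ih (by omega)

lemma count_first {t : ℕ} (c0 : Fin t → Bool) (j : Fin t) :
    2 ^ ((j : ℕ) + 1) * cnt (fun c : Fin t → Bool => c0 j ≠ c j ∧ ∀ i : Fin t, i < j → c0 i = c i) = 2 ^ t := by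
  have h1 := half_count (fun c : Fin t → Bool => ∀ i : Fin t, (i : ℕ) < (j : ℕ) → c i = c0 i) j (!c0 j) (by
      intro c
      apply forall_congr'
      intro i
      apply imp_congr_right
      intro hi
      rw [Function.update_of_ne (by intro h; rw [h] at hi; simp at hi)])
  rw [cnt_congr _ (fun c : Fin t → Bool => (∀ i : Fin t, (i : ℕ) < (j : ℕ) → c i = c0 i) ∧ c j = !c0 j) (by
    intro c
    have : c0 j ≠ c j ↔ c j = !c0 j := by cases c j <;> cases c0 j <;> simp
    rw [this, and_comm]
    apply and_congr_left'
    apply forall_congr'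
    intro i
    exact imp_congr Iff.rfl eq_comm)]
  rw [pow_succ, mul_assoc, h1]
  exact count_pfx c0 j (by omega)

lemma count_class {t : ℕ} (i0 i1 : Fin t) (h01 : i0 ≠ i1) (α β : Bool) :
    4 * cnt (fun c : Fin t → Bool => c i0 = α ∧ c i1 = β) = 2 ^ t := by
  have h1 := half_count (fun c : Fin t → Bool => c i0 = α) i1 β (by
    intro c; rw [Function.update_of_ne h01])
  have h2 := half_count (fun c : Fin t → Bool => True) i0 α (by simp)
  rw [cnt_true] at h2
  rw [cnt_congr _ (fun c : Fin t → Bool => c i0 = α) (by intro c; simp)] at h2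
  omega

lemma count_nclass {t : ℕ} (i0 i1 : Fin t) (h01 : i0 ≠ i1) (α β : Bool) :
    4 * cnt (fun c : Fin t → Bool => ¬ (α = c i0 ∧ β = c i1)) = 3 * 2 ^ t := by
  have h2 := count_class i0 i1 h01 α β
  have h3 := cnt_add (fun _ => True) (fun c : Fin t → Bool => c i0 = α ∧ c i1 = β)
  rw [cnt_true] at h3
  rw [cnt_congr _ (fun c : Fin t → Bool => c i0 = α ∧ c i1 = β) (by intro c; simp),
    cnt_congr (fun c : Fin t → Bool => True ∧ ¬ (c i0 = α ∧ c i1 = β))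
      (fun c : Fin t → Bool => ¬ (α = c i0 ∧ β = c i1)) (by intro c; simp [eq_comm])] at h3
  omega

lemma count_X {t : ℕ} (i0 i1 j : Fin t) (h01 : i0 ≠ i1) (hj0 : j ≠ i0) (hj1 : j ≠ i1) (α β e : Bool) :
    8 * cnt (fun c : Fin t → Bool => e ≠ c j ∧ ¬ (α = c i0 ∧ β = c i1)) = 3 * 2 ^ t := by
  have h1 := half_count (fun c : Fin t → Bool => ¬ (α = c i0 ∧ β = c i1)) j (!e) (by
    intro c; rw [Function.update_of_ne hj0.symm, Function.update_of_ne hj1.symm])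
  have h2 := count_nclass i0 i1 h01 α β
  rw [cnt_congr _ (fun c : Fin t → Bool => e ≠ c j ∧ ¬ (α = c i0 ∧ β = c i1)) (by
    intro c
    have : e ≠ c j ↔ c j = !e := by cases c j <;> cases e <;> simp
    rw [this, and_comm])] at h1
  omega

lemma stage2 {n : ℕ} (hn : Even n) (d t s : ℕ) (hd : 0 < d) (G : SimpleGraph (Fin n))
    (hreg : ∀ v, dgr G v = d) (x : Fin n → Fin t → Bool) (hx1 : ∀ v, x v.rev = cmpl (x v))
    (hx : ∀ v (p : (Fin t → Bool) → Prop),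
        |(cnt (fun u => G.Adj v u ∧ p (x u)) : ℝ) - d * cnt p / 2 ^ t| ≤ d / (2 ^ t) ^ 2)
    (i0 i1 : Fin t) (h01 : i0 ≠ i1) (hs : (2 : ℝ) ^ 35 * d ≤ 2 ^ s * 2 ^ t) (hT : (64 : ℝ) ≤ 2 ^ t)
    (hsd : (s : ℝ) ≤ d) (hbig : 4 * (d : ℝ) ^ 2 * Real.exp (-(d / 2 ^ 19)) ≤ 1 / 2 ^ 31) :
    ∃ y : Fin n → Fin s → Bool, (∀ v, y v.rev = cmpl (y v)) ∧
      (∀ u v, G.Adj u v → x u = x v → y u ≠ y v) ∧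
      ∀ v j, (0.36 : ℝ) * d ≤ cnt (fun u => G.Adj v u ∧ y v j ≠ y u j ∧
        ¬ (x v i0 = x u i0 ∧ x v i1 = x u i1)) := by
  set T : ℝ := (2 : ℝ) ^ t with hTdef
  have hT0 : 0 < T := by linarith
  have hd0 : (0 : ℝ) < d := by exact_mod_cast hd
  have hδ : (d : ℝ) / T ^ 2 ≤ d / 4096 := by
    apply div_le_div_of_nonneg_left hd0.le (by norm_num)
    nlinarith
  have hδ' : (d : ℝ) / T ^ 2 ≤ d / T := by
    apply div_le_div_of_nonneg_left hd0.le hT0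
    nlinarith
  let A : Fin n → Finset (Fin n) := fun v =>
    Finset.univ.filter (fun u => G.Adj v u ∧ ¬ (x v i0 = x u i0 ∧ x v i1 = x u i1))
  have hAc : ∀ v, (0.7497 : ℝ) * d ≤ (A v).card := by
    intro v
    have h1 := hx v (fun c => ¬ (x v i0 = c i0 ∧ x v i1 = c i1))
    have h2 := count_nclass i0 i1 h01 (x v i0) (x v i1)
    have h3 : (4 : ℝ) * cnt (fun c : Fin t → Bool => ¬ (x v i0 = c i0 ∧ x v i1 = c i1)) = 3 * T := by
      rw [hTdef]; exact_mod_cast h2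
    have h4 : (d : ℝ) * cnt (fun c : Fin t → Bool => ¬ (x v i0 = c i0 ∧ x v i1 = c i1)) / T = 3 / 4 * d := by
      rw [div_eq_iff hT0.ne']; linear_combination (d : ℝ) / 4 * h3
    rw [h4, cnt_eq] at h1
    have h5 := (abs_le.mp h1).1
    simp only [A]
    linarith
  have hη : (0 : ℝ) < 1 / 2 ^ 30 := by positivity
  obtain ⟨y, hy1, hy2, hy3⟩ := color_ex (s := s) hn (fun u v => G.Adj u v ∧ x u = x v) (2 * d / T)
    (fun u v h => ⟨h.1.symm, h.2.symm⟩)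
    (by
      intro v
      have h1 := hx v (fun c => x v = c)
      have h2 : cnt (fun c => x v = c) = 1 := by
        rw [cnt_eq, Finset.card_eq_one]
        exact ⟨x v, by ext c; simp [eq_comm]⟩
      rw [h2] at h1
      have h3 := (abs_le.mp h1).2
      have : ((cnt (fun u => G.Adj v u ∧ x v = x u) : ℕ) : ℝ) ≤ 2 * d / T := by
        have : 2 * (d : ℝ) / T = d / T + d / T := by ring
        have h5 : (d : ℝ) * (1 : ℕ) / T = d / T := by simp
        linarith
      rw [cnt_eq] at this
      convert this)
    (by
      rintro u v ⟨h1, h2⟩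
      refine ⟨h1.ne, ?_⟩
      intro h
      rw [h, hx1] at h2
      have := congrFun h2 i0
      simp [cmpl] at this)
    d hd A
    (by
      intro v
      rw [← hreg v]
      unfold dgr
      apply Finset.card_le_card
      intro u
      simp only [A, Finset.mem_filter, Finset.mem_univ, true_and]
      exact fun h => h.1)
    (by
      intro v
      rw [← Finset.card_pos]
      have := hAc v
      have : (0 : ℝ) < (A v).card := by nlinarith
      exact_mod_cast this)
    (by
      intro u
      rw [← hreg u]
      unfold dgr
      apply Finset.card_le_card
      intro v
      simp only [A, Finset.mem_filter, Finset.mem_univ, true_and]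
      exact fun h => h.1.symm)
    (fun (k : Fin s × Bool) (c : Fin s → Bool) => if c k.1 = k.2 then (1 / 2 : ℝ) else -(1 / 2))
    (by
      rintro ⟨j, e⟩ c
      simp only
      split_ifs <;> norm_num [abs_le])
    (by
      rintro ⟨j, e⟩
      simp only
      rw [Finset.sum_ite, Finset.sum_const, Finset.sum_const, nsmul_eq_mul, nsmul_eq_mul]
      have h1 := half_count (fun c : Fin s → Bool => True) j e (by simp)
      have h2 := cnt_add (fun c : Fin s → Bool => True) (fun c => c j = e)
      simp only [true_and] at h1 h2
      have h3 : cnt (fun c : Fin s → Bool => c j = e) = cnt (fun c : Fin s → Bool => ¬ c j = e) := by omega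
      rw [cnt_eq, cnt_eq] at h3
      rw [h3]; ring)
    (d / 128) (by positivity) (by linarith)
    (1 / 2 ^ 30) hη.le (by norm_num)
    (by
      have h1 : 4 * (2 * (d : ℝ) / T) / 2 ^ s / (1 - 1 / 2 ^ 30) ^ 2 ≤ 1 / 2 ^ 31 := by
        have h2 : 4 * (2 * (d : ℝ) / T) / 2 ^ s ≤ 1 / 2 ^ 32 := by
          rw [← mul_div_assoc, div_div, div_le_div_iff₀ (by positivity) (by positivity)]
          linarith
        calc 4 * (2 * (d : ℝ) / T) / 2 ^ s / (1 - 1 / 2 ^ 30) ^ 2 ≤ (1 / 2 ^ 32) / (1 - 1 / 2 ^ 30) ^ 2 := by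
              gcongr
          _ ≤ 1 / 2 ^ 31 := by norm_num
      have hP : Real.exp (-(d / 2 ^ 29)) ≤ (1 - 1 / 2 ^ 30 : ℝ) ^ d := by
        have h3 : Real.exp (-(1 / 2 ^ 29)) ≤ (1 - 1 / 2 ^ 30 : ℝ) := by
          rw [Real.exp_neg]
          have h4 : (1 : ℝ) / 2 ^ 29 + 1 ≤ Real.exp (1 / 2 ^ 29) := Real.add_one_le_exp _
          calc (Real.exp (1 / 2 ^ 29))⁻¹ ≤ ((1 : ℝ) / 2 ^ 29 + 1)⁻¹ := by
                apply inv_anti₀ _ h4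
                positivity
            _ ≤ _ := by norm_num
        calc Real.exp (-(d / 2 ^ 29)) = Real.exp (-(1 / 2 ^ 29)) ^ d := by
              rw [← Real.exp_nat_mul]; congr 1; ring
          _ ≤ _ := pow_le_pow_left₀ (Real.exp_pos _).le h3 d
      have hK : (Fintype.card (Fin s × Bool) : ℝ) ≤ 2 * d := by
        rw [Fintype.card_prod]; simp; linarith
      have h4 : 2 * (d : ℝ) * Fintype.card (Fin s × Bool) * Real.exp (-((d / 128) ^ 2 / (16 * d))) / (1 - 1 / 2 ^ 30) ^ d
          ≤ 1 / 2 ^ 31 := by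
        calc _ ≤ 2 * (d : ℝ) * (2 * d) * Real.exp (-((d / 128) ^ 2 / (16 * d))) / Real.exp (-(d / 2 ^ 29)) := by
              gcongr
          _ = 4 * (d : ℝ) ^ 2 * Real.exp (-((d / 128) ^ 2 / (16 * d)) - (-(d / 2 ^ 29))) := by
              rw [Real.exp_sub]; ring
          _ ≤ 4 * (d : ℝ) ^ 2 * Real.exp (-(d / 2 ^ 19)) := by
              gcongr
              have : ((d : ℝ) / 128) ^ 2 / (16 * d) = d / 2 ^ 18 := by
                field_simp; norm_num
              rw [this]
              have : (d : ℝ) / 2 ^ 18 = d / 2 ^ 19 + d / 2 ^ 19 := by ring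
              have : (d : ℝ) / 2 ^ 29 ≤ d / 2 ^ 19 := by
                apply div_le_div_of_nonneg_left hd0.le (by positivity) (by norm_num)
              linarith
          _ ≤ _ := hbig
      calc _ ≤ (1 : ℝ) / 2 ^ 31 + 1 / 2 ^ 31 := add_le_add h1 h4
        _ = 1 / 2 ^ 30 := by norm_num)
  refine ⟨y, hy1, fun u v h1 h2 => hy2 u v ⟨h1, h2⟩, ?_⟩
  intro v j
  have h1 := hy3 v (j, y v j)
  simp only at h1
  rw [Finset.sum_ite, Finset.sum_const, Finset.sum_const, nsmul_eq_mul, nsmul_eq_mul] at h1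
  have h2 := Finset.card_filter_add_card_filter_not (s := A v) (fun u => y u j = y v j)
  have h3 : (((A v).filter (fun u => y u j = y v j)).card : ℝ) + ((A v).filter (fun u => ¬ y u j = y v j)).card = (A v).card := by
    exact_mod_cast h2
  have h4 := hAc v
  have h5 : cnt (fun u => G.Adj v u ∧ y v j ≠ y u j ∧ ¬ (x v i0 = x u i0 ∧ x v i1 = x u i1))
      = ((A v).filter (fun u => ¬ y u j = y v j)).card := by
    rw [cnt_eq]
    congr 1
    ext u
    simp only [A, Finset.mem_filter, Finset.mem_univ, true_and]
    constructor
    · rintro ⟨a, b, c⟩; exact ⟨⟨a, c⟩, fun h => b h.symm⟩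
    · rintro ⟨⟨a, c⟩, b⟩; exact ⟨a, fun h => b h.symm, c⟩
  rw [h5]
  linarith

lemma dgr_eq_degree {n : ℕ} (H : SimpleGraph (Fin n)) (v : Fin n) [Fintype (H.neighborSet v)] :
    H.degree v = dgr H v := by
  rw [← SimpleGraph.card_neighborFinset_eq_degree]
  unfold dgr
  congr 1
  ext u
  simp

lemma pow_big (t : ℕ) (ht : 40 ≤ t) : 64000 * (16 * t + 52) ≤ 2 ^ t := by
  induction t, ht using Nat.le_induction with
  | base => norm_num
  | succ t ht ih => rw [pow_succ]; omega

lemma ev1 : ∀ᶠ d : ℕ in Filter.atTop, 16 * (d : ℝ) ^ 3 ≤ Real.exp (Real.sqrt d / 16) := by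
  have h1 := Real.tendsto_pow_mul_exp_neg_atTop_nhds_zero 6
  have h2 : Filter.Tendsto (fun d : ℕ => Real.sqrt d / 16) Filter.atTop Filter.atTop :=
    Filter.Tendsto.atTop_div_const (by norm_num) (Real.tendsto_sqrt_atTop.comp tendsto_natCast_atTop_atTop)
  have h3 := (h1.comp h2).eventually (ge_mem_nhds (show (0 : ℝ) < 1 / (16 * 256 ^ 3) by norm_num))
  filter_upwards [h3] with d hd
  simp only [Function.comp] at hd
  rw [Real.exp_neg, ← div_eq_mul_inv, div_le_iff₀ (Real.exp_pos _)] at hd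
  have h4 : (Real.sqrt d / 16) ^ 6 = (d : ℝ) ^ 3 / 256 ^ 3 := by
    have : Real.sqrt d ^ 2 = d := Real.sq_sqrt (by positivity)
    calc (Real.sqrt d / 16) ^ 6 = (Real.sqrt d ^ 2) ^ 3 / 256 ^ 3 := by ring
      _ = _ := by rw [this]
  rw [h4] at hd
  linarith

lemma ev2 : ∀ᶠ d : ℕ in Filter.atTop, 4 * (d : ℝ) ^ 2 * Real.exp (-(d / 2 ^ 19)) ≤ 1 / 2 ^ 31 := by
  have h1 := Real.tendsto_pow_mul_exp_neg_atTop_nhds_zero 2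
  have h2 : Filter.Tendsto (fun d : ℕ => (d : ℝ) / 2 ^ 19) Filter.atTop Filter.atTop :=
    Filter.Tendsto.atTop_div_const (by norm_num) tendsto_natCast_atTop_atTop
  have h3 := (h1.comp h2).eventually (ge_mem_nhds (show (0 : ℝ) < 1 / (4 * 2 ^ 38 * 2 ^ 31) by norm_num))
  filter_upwards [h3] with d hd
  simp only [Function.comp] at hd
  have h4 : 4 * (d : ℝ) ^ 2 * Real.exp (-(d / 2 ^ 19)) = 4 * 2 ^ 38 * (((d : ℝ) / 2 ^ 19) ^ 2 * Real.exp (-(d / 2 ^ 19))) := by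
    ring
  rw [h4]
  calc _ ≤ 4 * 2 ^ 38 * ((1 : ℝ) / (4 * 2 ^ 38 * 2 ^ 31)) := by gcongr
    _ = 1 / 2 ^ 31 := by norm_num

lemma decomp {n : ℕ} (d L t k s : ℕ) (hn : Even n) (hn0 : 0 < n)
    (hL : L = Nat.log 2 d) (ht : t = L / 16) (hk : k = L + 36) (hs : s = k - t) (ht40 : 40 ≤ t)
    (hd : 2 ≤ d)
    (hb1 : 16 * (d : ℝ) ^ 3 ≤ Real.exp (Real.sqrt d / 16))
    (hb2 : 4 * (d : ℝ) ^ 2 * Real.exp (-(d / 2 ^ 19)) ≤ 1 / 2 ^ 31)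
    (G : SimpleGraph (Fin n)) (hreg : ∀ v, dgr G v = d)
    (heml : ∀ S U : Finset (Fin n),
      (eC G S U : ℝ) ≤ d / n * S.card * U.card + d / 24 * (S.card + U.card)) :
    ∃ (b : ℕ → Fin n → Bool) (Hs : ℕ → SimpleGraph (Fin n)),
      (∀ i j, i < j → j < k → ∀ u v, (Hs i).Adj u v → ¬ (Hs j).Adj u v) ∧
      (∀ u v, G.Adj u v ↔ ∃ i < k, (Hs i).Adj u v) ∧
      (∀ i < k, ∃ r, ∀ v, dgr (Hs i) v = r) ∧
      (∀ i < k, ∀ u v, (Hs i).Adj u v → b i u ≠ b i v) := by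
  have hd0 : (0 : ℝ) < d := by exact_mod_cast (by omega : 0 < d)
  have hpL : 2 ^ L ≤ d := by rw [hL]; exact Nat.pow_log_le_self 2 (by omega)
  have hpL1 : d < 2 ^ (L + 1) := by rw [hL]; exact Nat.lt_pow_succ_log_self (by norm_num) d
  set T : ℝ := (2 : ℝ) ^ t with hTdef
  have hT16 : T ^ 16 ≤ d := by
    rw [hTdef, ← pow_mul]
    calc (2 : ℝ) ^ (t * 16) ≤ 2 ^ L := pow_le_pow_right₀ (by norm_num) (by omega)
      _ ≤ d := by exact_mod_cast hpL
  have hTbig : (64000 : ℝ) * (k + 1) ≤ T := by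
    have h1 := pow_big t ht40
    have h2 : 64000 * (k + 1) ≤ 2 ^ t := le_trans (by omega) h1
    rw [hTdef]; exact_mod_cast h2
  have hk0 : (0 : ℝ) ≤ k := by positivity
  have hT64 : (64000 : ℝ) ≤ T := by linarith
  have hT0 : 0 < T := by linarith
  have hTd : T ≤ d := le_trans (le_self_pow₀ (by linarith) (by norm_num)) hT16
  obtain ⟨x, hx1, hx⟩ := stage1 hn d t hd G hreg hT16 hb1
  let i0 : Fin t := ⟨0, by omega⟩
  let i1 : Fin t := ⟨1, by omega⟩
  have h01 : i0 ≠ i1 := by simp [i0, i1]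
  obtain ⟨y, hy1, hy2, hy3⟩ := stage2 hn d t s (by omega) G hreg x hx1 hx i0 i1 h01
    (by
      rw [← pow_add, show s + t = (L + 1) + 35 by omega, pow_add (2 : ℝ) (L + 1) 35]
      have : (d : ℝ) ≤ 2 ^ (L + 1) := by exact_mod_cast hpL1.le
      rw [mul_comm]
      exact mul_le_mul_of_nonneg_right this (by positivity))
    (by rw [← hTdef]; linarith)
    (by
      have : (s : ℝ) ≤ k := by exact_mod_cast (by omega : s ≤ k)
      linarith) hb2
  let b : ℕ → Fin n → Bool := fun j v =>
    if h : j < t then x v ⟨j, h⟩ else if h : j - t < s then y v ⟨j - t, h⟩ else false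
  have bx : ∀ j (h : j < t) v, b j v = x v ⟨j, h⟩ := by
    intro j h v; simp only [b, dif_pos h]
  have byEq : ∀ j (h : ¬ j < t) (h' : j - t < s) v, b j v = y v ⟨j - t, h'⟩ := by
    intro j h h' v; simp only [b, dif_neg h, dif_pos h']
  have bx0 : ∀ v, b 0 v = x v i0 := fun v => bx 0 _ v
  have bx1 : ∀ v, b 1 v = x v i1 := fun v => bx 1 _ v
  set δ : ℝ := d / T ^ 2 with hδ
  have hδ0 : 0 ≤ δ := by positivity
  have hδT : δ ≤ d / T := by
    rw [hδ]
    apply div_le_div_of_nonneg_left hd0.le hT0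
    nlinarith
  have hδs : δ ≤ d / 64000 := hδT.trans (div_le_div_of_nonneg_left hd0.le (by norm_num) hT64)
  set w : ℕ := ⌈2 * d / T⌉₊ with hw
  have hw1 : 2 * d / T ≤ w := Nat.le_ceil _
  have hdT1 : 1 ≤ d / T := by rw [le_div_iff₀ hT0]; linarith
  have hw2 : (w : ℝ) ≤ 3 * d / T := by
    have := (Nat.ceil_lt_add_one (show (0 : ℝ) ≤ 2 * d / T by positivity)).le
    have e : 3 * d / T = 2 * d / T + d / T := by ring
    rw [e]; linarith
  have hδw : 2 * δ ≤ w := by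
    have e : 2 * d / T = 2 * (d / T) := by ring
    linarith
  have hwk : (w : ℝ) * (k + 1) ≤ 3 / 64000 * d := by
    calc (w : ℝ) * (k + 1) ≤ (3 * d / T) * (T / 64000) := by
          apply mul_le_mul hw2 _ (by positivity) (by positivity)
          rw [le_div_iff₀ (by norm_num)]; linarith
      _ = _ := by field_simp
  have hd12 : (2 : ℝ) ^ 36 ≤ d := by
    have : (2 : ℝ) ^ 36 ≤ T := by
      rw [hTdef]; exact pow_le_pow_right₀ (by norm_num) (by omega)
    linarith
  have hw0 : (0 : ℝ) ≤ w := by positivity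
  have hwk0 : (0 : ℝ) ≤ w * k := by positivity
  -- degree formula for bits below t
  have hLdeg : ∀ j (h : j < t) v, |(dgr (Lj G b j) v : ℝ) - d / 2 ^ (j + 1)| ≤ δ := by
    intro j h v
    have h1 := hx v (fun c => x v ⟨j, h⟩ ≠ c ⟨j, h⟩ ∧ ∀ i : Fin t, i < ⟨j, h⟩ → x v i = c i)
    have h2 := count_first (x v) ⟨j, h⟩
    have h3 : (2 : ℝ) ^ (j + 1) * cnt (fun c : Fin t → Bool => x v ⟨j, h⟩ ≠ c ⟨j, h⟩ ∧ ∀ i : Fin t, i < ⟨j, h⟩ → x v i = c i) = T := by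
      rw [hTdef]; exact_mod_cast h2
    have h4 : (d : ℝ) * cnt (fun c : Fin t → Bool => x v ⟨j, h⟩ ≠ c ⟨j, h⟩ ∧ ∀ i : Fin t, i < ⟨j, h⟩ → x v i = c i) / T = d / 2 ^ (j + 1) := by
      rw [div_eq_div_iff hT0.ne' (by positivity), ← h3]; ring
    rw [h4] at h1
    have h5 : dgr (Lj G b j) v = cnt (fun u => G.Adj v u ∧ (x v ⟨j, h⟩ ≠ x u ⟨j, h⟩ ∧ ∀ i : Fin t, i < ⟨j, h⟩ → x v i = x u i)) := by
      apply cnt_congr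
      intro u
      show (G.Adj v u ∧ b j v ≠ b j u ∧ ∀ i < j, b i v = b i u) ↔ _
      rw [bx j h, bx j h]
      apply and_congr_right'
      apply and_congr_right'
      constructor
      · intro hh i hi
        have := hh i hi
        rw [bx i i.2, bx i i.2] at this
        exact this
      · intro hh i hi
        rw [bx i (by omega), bx i (by omega)]
        exact hh _ hi
    rw [h5]; exact h1
  let l : ℕ → ℕ := fun j => if j < t then ⌈(d : ℝ) / 2 ^ (j + 1) - δ⌉₊ else 0
  have hcl : ∀ v α β, |(((cls b α β).filter (fun u => G.Adj v u)).card : ℝ) - d / 4| ≤ δ := by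
    intro v α β
    have h1 := hx v (fun c => c i0 = α ∧ c i1 = β)
    have h2 := count_class i0 i1 h01 α β
    have h3 : (4 : ℝ) * cnt (fun c : Fin t → Bool => c i0 = α ∧ c i1 = β) = T := by
      rw [hTdef]; exact_mod_cast h2
    have h4 : (d : ℝ) * cnt (fun c : Fin t → Bool => c i0 = α ∧ c i1 = β) / T = d / 4 := by
      rw [div_eq_div_iff hT0.ne' (by positivity), ← h3]; ring
    rw [h4] at h1
    have h5 : ((cls b α β).filter (fun u => G.Adj v u)).card = cnt (fun u => G.Adj v u ∧ (x u i0 = α ∧ x u i1 = β)) := by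
      rw [cnt_eq]
      congr 1
      ext u
      simp only [Finset.mem_filter, Finset.mem_univ, true_and, mem_cls, bx0, bx1]
      tauto
    rw [h5]; exact h1
  set q : ℕ := ⌈(d : ℝ) / 4 - δ⌉₊ with hq
  have hq1 : (d : ℝ) / 4 - δ ≤ q := Nat.le_ceil _
  set m3 : ℕ := ⌊(0.36 : ℝ) * d⌋₊ with hm3
  have hm31 : (m3 : ℝ) ≤ 0.36 * d := Nat.floor_le (by positivity)
  have hm32 : (0.36 : ℝ) * d < m3 + 1 := Nat.lt_floor_add_one _
  refine ⟨b, structural d (by omega) hn0 G hreg heml b k (by omega) ?_ ?_ w l ?_ ?_ m3 ?_ ?_ q w ?_ ?_ ?_⟩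
  · intro j hj v
    by_cases h : j < t
    · rw [bx j h, bx j h, hx1]; rfl
    · rw [byEq j h (by omega), byEq j h (by omega), hy1]; rfl
  · intro u v h
    by_cases hxe : x u = x v
    · have := hy2 u v h hxe
      obtain ⟨i, hi⟩ := Function.ne_iff.mp this
      have hi2 := i.2
      refine ⟨t + i, by omega, ?_⟩
      rw [byEq (t + i) (by omega) (by omega), byEq (t + i) (by omega) (by omega)]
      have : (⟨t + i - t, by omega⟩ : Fin s) = i := by ext; simp
      rw [this]; exact hi
    · obtain ⟨i, hi⟩ := Function.ne_iff.mp hxe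
      refine ⟨i, by omega, ?_⟩
      rw [bx i i.2, bx i i.2]; exact hi
  · intro j hj2 hjk v
    simp only [l]
    split_ifs with h
    · rw [Nat.ceil_le]
      have := (abs_le.mp (hLdeg j h v)).1
      linarith
    · exact Nat.zero_le _
  · intro j hj2 hjk v
    simp only [l]
    split_ifs with h
    · have h1 := (abs_le.mp (hLdeg j h v)).2
      have h2 := Nat.le_ceil ((d : ℝ) / 2 ^ (j + 1) - δ)
      have : (dgr (Lj G b j) v : ℝ) ≤ ⌈(d : ℝ) / 2 ^ (j + 1) - δ⌉₊ + w := by linarith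
      exact_mod_cast this
    · rw [zero_add]
      have h0 : dgr (Lj G b j) v ≤ cnt (fun u => G.Adj v u ∧ x v = x u) := by
        apply cnt_mono
        intro u hu
        refine ⟨hu.1, ?_⟩
        funext i
        have := hu.2.2 i (by omega)
        rw [bx i i.2, bx i i.2] at this
        exact this
      have h1 := hx v (fun c => x v = c)
      have h2 : cnt (fun c => x v = c) = 1 := by
        rw [cnt_eq, Finset.card_eq_one]
        exact ⟨x v, by ext c; simp [eq_comm]⟩
      rw [h2] at h1
      have h3 := (abs_le.mp h1).2
      have h5 : (d : ℝ) * (1 : ℕ) / T = d / T := by simp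
      have h6 : ((cnt (fun u => G.Adj v u ∧ x v = x u) : ℕ) : ℝ) ≤ w := by
        have e : 2 * d / T = d / T + d / T := by ring
        linarith
      have h7 : cnt (fun u => G.Adj v u ∧ x v = x u) ≤ w := by exact_mod_cast h6
      exact h0.trans h7
  · intro j hj2 hjk v
    by_cases h : j < t
    · have h1 := hx v (fun c => x v ⟨j, h⟩ ≠ c ⟨j, h⟩ ∧ ¬ (x v i0 = c i0 ∧ x v i1 = c i1))
      have h2 := count_X i0 i1 ⟨j, h⟩ h01 (by simp [i0]; omega) (by simp [i1]; omega) (x v i0) (x v i1) (x v ⟨j, h⟩)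
      have h3 : (8 : ℝ) * cnt (fun c : Fin t → Bool => x v ⟨j, h⟩ ≠ c ⟨j, h⟩ ∧ ¬ (x v i0 = c i0 ∧ x v i1 = c i1)) = 3 * T := by
        rw [hTdef]; exact_mod_cast h2
      have h4 : (d : ℝ) * cnt (fun c : Fin t → Bool => x v ⟨j, h⟩ ≠ c ⟨j, h⟩ ∧ ¬ (x v i0 = c i0 ∧ x v i1 = c i1)) / T = 3 / 8 * d := by
        rw [div_eq_iff hT0.ne']; linear_combination (d : ℝ) / 8 * h3
      rw [h4] at h1
      have h5 : dgr (Xj G b j) v = cnt (fun u => G.Adj v u ∧ (x v ⟨j, h⟩ ≠ x u ⟨j, h⟩ ∧ ¬ (x v i0 = x u i0 ∧ x v i1 = x u i1))) := by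
        apply cnt_congr
        intro u
        show (G.Adj v u ∧ b j v ≠ b j u ∧ ¬ (b 0 v = b 0 u ∧ b 1 v = b 1 u)) ↔ _
        rw [bx j h, bx j h, bx0, bx0, bx1, bx1]
      rw [← h5] at h1
      have h6 := (abs_le.mp h1).1
      have : (m3 : ℝ) ≤ dgr (Xj G b j) v := by linarith
      exact_mod_cast this
    · have h1 := hy3 v ⟨j - t, by omega⟩
      have h5 : dgr (Xj G b j) v = cnt (fun u => G.Adj v u ∧ y v ⟨j - t, by omega⟩ ≠ y u ⟨j - t, by omega⟩ ∧ ¬ (x v i0 = x u i0 ∧ x v i1 = x u i1)) := by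
        apply cnt_congr
        intro u
        show (G.Adj v u ∧ b j v ≠ b j u ∧ ¬ (b 0 v = b 0 u ∧ b 1 v = b 1 u)) ↔ _
        rw [byEq j h (by omega), byEq j h (by omega), bx0, bx0, bx1, bx1]
      rw [← h5] at h1
      have : (m3 : ℝ) ≤ dgr (Xj G b j) v := by linarith
      exact_mod_cast this
  · have : (w : ℝ) * (k + 1) = w * k + w := by ring
    rw [this] at hwk
    have : 21 * (w : ℝ) * k = 21 * (w * k) := by ring
    rw [this]
    linarith
  · intro v α β
    rw [hq, Nat.ceil_le]
    have := (abs_le.mp (hcl v α β)).1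
    linarith
  · intro v α β
    have := (abs_le.mp (hcl v α β)).2
    have : (((cls b α β).filter (fun u => G.Adj v u)).card : ℝ) ≤ q + w := by linarith
    exact_mod_cast this
  · have : (w : ℝ) * (k + 1) = w * k + w := by ring
    rw [this] at hwk
    have : 21 * (w : ℝ) * k = 21 * (w * k) := by ring
    rw [this]
    linarith

theorem stmt_11 :
    ∃ d₀ : ℕ, ∀ d : ℕ, d₀ ≤ d → ∀ n : ℕ, Even n → d + 1 ≤ n →
      ∀ G : SimpleGraph (Fin n), G.IsRegularOfDegree d →
      ∀ hA : (SimpleGraph.adjMatrix ℝ G).IsHermitian,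
      ∀ i₀ : Fin n, hA.eigenvalues i₀ = d →
      (∀ i, i ≠ i₀ → |hA.eigenvalues i| ≤ (d : ℝ) / 12) →
      ∃ (k : ℕ) (Hs : Fin k → SimpleGraph (Fin n)),
        (k : ℝ) ≤ Real.logb 2 d + 36 ∧
        (∀ i j, i ≠ j → Disjoint (Hs i).edgeSet (Hs j).edgeSet) ∧
        (⋃ i, (Hs i).edgeSet) = G.edgeSet ∧
        (∀ i, ∃ r, (Hs i).IsRegularOfDegree r) ∧
        (∀ i, (Hs i).Colorable 2) := by
  obtain ⟨D, hD⟩ := Filter.eventually_atTop.mp (ev1.and ev2)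
  refine ⟨max D (2 ^ 640), ?_⟩
  intro d hd n hn hdn G hG hA i₀ h0 hl
  have hdD : D ≤ d := le_trans (le_max_left _ _) hd
  have hd640 : 2 ^ 640 ≤ d := le_trans (le_max_right _ _) hd
  have hd2 : 2 ≤ d := le_trans (le_trans (by norm_num) (Nat.pow_le_pow_right (by norm_num) (by norm_num : 1 ≤ 640))) hd640
  have hlog : 640 ≤ Nat.log 2 d := Nat.le_log_of_pow_le (by norm_num) hd640
  obtain ⟨hb1, hb2⟩ := hD d hdD
  have hreg : ∀ v, dgr G v = d := by
    intro v
    rw [← dgr_eq_degree]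
    exact hG v
  have hn0 : 0 < n := by omega
  have heml := eml d (by omega) hn0 G hreg hA i₀ h0 hl
  obtain ⟨b, Hs, h1, h2, h3, h4⟩ := decomp d (Nat.log 2 d) (Nat.log 2 d / 16) (Nat.log 2 d + 36)
    (Nat.log 2 d + 36 - Nat.log 2 d / 16) hn hn0 rfl rfl rfl rfl (by omega) hd2 hb1 hb2 G hreg heml
  refine ⟨Nat.log 2 d + 36, fun i => Hs i, ?_, ?_, ?_, ?_, ?_⟩
  · push_cast
    have := Real.natLog_le_logb d 2
    push_cast at this
    linarith
  · intro i j hij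
    rw [Set.disjoint_left]
    intro e
    induction e using Sym2.ind with
    | _ u v =>
      simp only [SimpleGraph.mem_edgeSet]
      intro hi hj
      rcases lt_or_gt_of_ne (fun h => hij (Fin.ext h) : (i : ℕ) ≠ j) with h | h
      · exact h1 i j h j.2 u v hi hj
      · exact h1 j i h i.2 u v hj hi
  · ext e
    induction e using Sym2.ind with
    | _ u v =>
      simp only [Set.mem_iUnion, SimpleGraph.mem_edgeSet]
      rw [h2]
      constructor
      · rintro ⟨i, hi⟩; exact ⟨i, i.2, hi⟩
      · rintro ⟨i, hi, h⟩; exact ⟨⟨i, hi⟩, h⟩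
  · intro i
    obtain ⟨r, hr⟩ := h3 i i.2
    refine ⟨r, fun v => ?_⟩
    rw [dgr_eq_degree]
    exact hr v
  · intro i
    exact (SimpleGraph.Coloring.mk (b i) (fun {u v} h => h4 i i.2 u v h) : (Hs i).Coloring Bool).colorable
end
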